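/- Let ψ : ℝ⁺ → ℝ⁺ be a monotonic function with ψ(h) → 0 as h → ∞, and let 1 < s ≤ 2. If Σ_{h=1}^∞ ψ(h)^{s−1} h^{4−2s} < ∞ then H^s(S₂(ψ)) = 0; if this sum diverges then H^s(S₂(ψ)) = H^s([0,1)²) (assuming the Lebesgue full-measure statement for S₂ in the divergence case). -/

import Mathlib

open MeasureTheory Set Filter
open scoped ENNReal

def IsDimFun (f : ℝ → ℝ) : Prop :=
  ContinuousOn f (Set.Ici 0) ∧ MonotoneOn f (Set.Ici 0) ∧
    (∀ r, 0 ≤ r → 0 ≤ f r) ∧ Filter.Tendsto f (nhdsWithin 0 (Set.Ioi 0)) (nhds 0)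

noncomputable def hMeasure {X : Type*} [EMetricSpace X] [MeasurableSpace X] [BorelSpace X]
    (f : ℝ → ℝ) : Measure X :=
  Measure.mkMetric (fun d => ENNReal.ofReal (f d.toReal))

/-- The set `S₂(ψ)` of `x ∈ [0,1)²` with `|a² · x - p²| < ψ(|a|)` for infinitely
many `(a, p) ∈ ℤ² × ℤ`. -/
def S2 (ψ : ℝ → ℝ) : Set (EuclideanSpace ℝ (Fin 2)) :=
  {x | (∀ i, x i ∈ Set.Ico (0:ℝ) 1) ∧
    {q : (Fin 2 → ℤ) × ℤ |
      |(q.1 0 : ℝ) ^ 2 * x 0 + (q.1 1 : ℝ) ^ 2 * x 1 - (q.2 : ℝ) ^ 2| <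
        ψ ((max (q.1 0).natAbs (q.1 1).natAbs : ℕ) : ℝ)}.Infinite}

/-- The unit box `[0,1)²`. -/
def box2 : Set (EuclideanSpace ℝ (Fin 2)) := {x | ∀ i, x i ∈ Set.Ico (0:ℝ) 1}

/-- `μ` is a measure with density at most `M`, carried by the open set `V ⊆ (0,1)`. -/
structure Carr (V : Set ℝ) (M : ℝ) (μ : Measure ℝ) : Prop where
  isOpen : IsOpen V
  sub : V ⊆ Ioo 0 1
  null : μ Vᶜ = 0
  nonneg : 0 ≤ M
  dens : ∀ s, μ s ≤ ENNReal.ofReal M * volume s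

lemma Carr.finite {V : Set ℝ} {M : ℝ} {μ : Measure ℝ} (h : Carr V M μ) : IsFiniteMeasure μ := by
  constructor
  have h1 : μ univ ≤ μ V + μ Vᶜ := by
    rw [← union_compl_self V]; exact measure_union_le _ _
  rw [h.null, add_zero] at h1
  have h2 : μ V ≤ ENNReal.ofReal M * volume (Ioo (0:ℝ) 1) :=
    (measure_mono h.sub).trans (h.dens _)
  refine (h1.trans h2).trans_lt ?_
  rw [Real.volume_Ioo]
  exact ENNReal.mul_lt_top ENNReal.ofReal_lt_top ENNReal.ofReal_lt_top

lemma Carr.real_le {V : Set ℝ} {M : ℝ} {μ : Measure ℝ} (h : Carr V M μ) {s : Set ℝ}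
    (hs : volume s ≠ ⊤) : μ.real s ≤ M * volume.real s := by
  have := ENNReal.toReal_mono (ENNReal.mul_ne_top ENNReal.ofReal_ne_top hs) (h.dens s)
  rwa [ENNReal.toReal_mul, ENNReal.toReal_ofReal h.nonneg] at this

lemma Carr.real_Icc_le {V : Set ℝ} {M : ℝ} {μ : Measure ℝ} (h : Carr V M μ) {u v : ℝ}
    (huv : u ≤ v) : μ.real (Icc u v) ≤ M * (v - u) := by
  have := h.real_le (s := Icc u v) (by simp)
  rwa [Real.volume_real_Icc_of_le huv] at this

/-- Selection of finitely many disjoint balls carrying most of the mass (Vitali). -/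
lemma select_balls {ι : Type*} (c R : ι → ℝ) (T : Set ι) (hR : ∀ i ∈ T, 0 < R i)
    (hcov : ∀ᵐ y : ℝ, y ∈ Ioo (0:ℝ) 1 → ∀ ε > 0, ∃ i ∈ T, R i ≤ ε ∧
      y ∈ Metric.closedBall (c i) (R i))
    {V : Set ℝ} {M : ℝ} {μ : Measure ℝ} (h : Carr V M μ) (σ : ℝ) (hσ : 0 < σ)
    (ρ : ℝ) (hρ : 0 < ρ) :
    ∃ F : Finset (ι × ℝ), (∀ p ∈ F, p.1 ∈ T ∧ R p.1 ≤ ρ ∧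
      Metric.closedBall (c p.1) (R p.1) ⊆ V) ∧
      (F : Set (ι × ℝ)).PairwiseDisjoint (fun p => Metric.closedBall (c p.1) (R p.1)) ∧
      μ.real univ - σ ≤ ∑ p ∈ F, μ.real (Metric.closedBall (c p.1) (R p.1)) := by
  have := h.finite
  set s : Set ℝ := {y | y ∈ V ∧ ∀ ε > 0, ∃ i ∈ T, R i ≤ ε ∧
      y ∈ Metric.closedBall (c i) (R i)} with hs
  set B : ι × ℝ → Set ℝ := fun p => Metric.closedBall (c p.1) (R p.1) with hB
  set T' : Set (ι × ℝ) := {p | p.1 ∈ T ∧ R p.1 ≤ ρ ∧ B p ⊆ V ∧ p.2 ∈ B p} with hT'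
  obtain ⟨u, huT, hucount, hudisj, hunull⟩ := Vitali.exists_disjoint_covering_ae
    (volume : Measure ℝ) s T' 6 (fun p => 2 * R p.1) (fun p => p.2) B
    (by
      rintro p ⟨hp1, hp2, hp3, hp4⟩
      intro z hz
      simp only [hB, Metric.mem_closedBall, Real.dist_eq] at hz hp4 ⊢
      rw [abs_le] at *
      constructor <;> linarith)
    (by
      rintro p ⟨hp1, hp2, hp3, hp4⟩
      simp only [hB, Real.volume_closedBall]
      rw [show ((6 : NNReal) : ℝ≥0∞) = ENNReal.ofReal 6 by simp,
        ← ENNReal.ofReal_mul (by norm_num)]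
      apply ENNReal.ofReal_le_ofReal
      linarith)
    (by
      rintro p ⟨hp1, hp2, hp3, hp4⟩
      refine ⟨c p.1, ?_⟩
      apply Metric.ball_subset_interior_closedBall
      exact Metric.mem_ball_self (hR _ hp1))
    (fun p _ => Metric.isClosed_closedBall)
    (by
      rintro x ⟨hxV, hx⟩ ε hε
      obtain ⟨δ, hδ, hδV⟩ := Metric.isOpen_iff.1 h.isOpen x hxV
      obtain ⟨i, hi, hRi, hxi⟩ := hx (min (min (ε/2) ρ) (δ/3)) (by positivity)
      have h1 : R i ≤ ε / 2 := hRi.trans ((min_le_left _ _).trans (min_le_left _ _))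
      have h2 : R i ≤ ρ := hRi.trans ((min_le_left _ _).trans (min_le_right _ _))
      have h3 : R i ≤ δ / 3 := hRi.trans (min_le_right _ _)
      refine ⟨(i, x), ⟨hi, h2, ?_, hxi⟩, by simp only; linarith, rfl⟩
      intro z hz
      apply hδV
      simp only [hB, Metric.mem_closedBall, Metric.mem_ball, Real.dist_eq] at hz hxi ⊢
      rw [abs_le] at *
      rw [abs_lt]
      constructor <;> linarith)
  -- all of the mass
  have hVs : volume (V \ s) = 0 := by
    refine measure_mono_null ?_ (ae_iff.1 hcov)
    intro y hy
    simp only [mem_ofPred_eq]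
    intro hcon
    exact hy.2 ⟨hy.1, hcon (h.sub hy.1)⟩
  have hVu : volume (V \ ⋃ p ∈ u, B p) = 0 := by
    refine measure_mono_null (t := (V \ s) ∪ (s \ ⋃ p ∈ u, B p)) ?_
      (measure_union_null hVs hunull)
    intro y hy
    by_cases hys : y ∈ s
    · exact Or.inr ⟨hys, hy.2⟩
    · exact Or.inl ⟨hy.1, hys⟩
  have hμu : μ (⋃ p ∈ u, B p)ᶜ = 0 := by
    refine measure_mono_null (t := Vᶜ ∪ (V \ ⋃ p ∈ u, B p)) ?_ (measure_union_null h.null ?_)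
    · intro y hy
      by_cases hyV : y ∈ V
      · exact Or.inr ⟨hyV, hy⟩
      · exact Or.inl hyV
    · refine le_antisymm ((h.dens _).trans ?_) bot_le
      rw [hVu, mul_zero]
  have hmu : μ univ = ∑' p : u, μ (B p) := by
    rw [← measure_biUnion hucount hudisj (fun p _ => Metric.isClosed_closedBall.measurableSet)]
    refine le_antisymm ?_ (measure_mono (subset_univ _))
    rw [← union_compl_self (⋃ p ∈ u, B p)]
    refine (measure_union_le _ _).trans ?_
    rw [hμu, add_zero]
  have hfin : ∑' p : u, μ (B p) ≠ ⊤ := by rw [← hmu]; exact measure_ne_top _ _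
  have hsum := ENNReal.hasSum_toReal hfin
  have htot : μ.real univ = ∑' p : u, (μ (B p)).toReal := by
    rw [measureReal_def, hmu, ENNReal.tsum_toReal_eq]
    exact fun a => measure_ne_top _ _
  rw [← htot] at hsum
  obtain ⟨G, hG⟩ := (hsum.eventually (lt_mem_nhds (by linarith : μ.real univ - σ < μ.real univ))).exists
  classical
  refine ⟨G.map (Function.Embedding.subtype _), ?_, ?_, ?_⟩
  · intro p hp
    simp only [Finset.mem_map, Function.Embedding.subtype_apply, Subtype.exists,
      exists_and_right, exists_eq_right] at hp
    obtain ⟨hpu, -⟩ := hp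
    exact ⟨(huT hpu).1, (huT hpu).2.1, (huT hpu).2.2.1⟩
  · refine hudisj.subset ?_
    intro p hp
    simp only [Finset.coe_map, Function.Embedding.subtype_apply, mem_image, Finset.mem_coe,
      Subtype.exists, exists_and_right, exists_eq_right] at hp
    exact hp.1
  · rw [Finset.sum_map]
    exact hG.le

/-- One layer of the mass transference construction. -/
lemma weak_step {ι : Type*} (c R : ι → ℝ) (T : Set ι) (hR : ∀ i ∈ T, 0 < R i)
    (t : ℝ) (ht0 : 0 < t) (ht1 : t < 1)
    (hcov : ∀ᵐ y : ℝ, y ∈ Ioo (0:ℝ) 1 → ∀ ε > 0, ∃ i ∈ T, R i ≤ ε ∧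
      y ∈ Metric.closedBall (c i) (R i))
    {V : Set ℝ} {M : ℝ} {μ : Measure ℝ} (h : Carr V M μ) (σ : ℝ) (hσ : 0 < σ) :
    ∃ V' M' μ', Carr V' M' μ' ∧ closure V' ⊆ V ∧
      closure V' ⊆ ⋃ i ∈ T, Metric.closedBall (c i) (R i ^ (1 / t)) ∧
      μ.real univ - σ ≤ μ'.real univ ∧
      (∀ u d, σ ≤ d → d ≤ 1 → μ'.real (Icc u (u + d)) ≤ μ.real (Icc u (u + d)) + σ * d ^ t) ∧
      (∀ u d, 0 < d → d ≤ 1 → μ'.real (Icc u (u + d)) ≤ 9 * M * d ^ t) := by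
  have := h.finite
  have hM := h.nonneg
  set ρ : ℝ := min 1 (σ * σ ^ t / (4 * (M + 1))) with hρdef
  have hσt : 0 < σ ^ t := Real.rpow_pos_of_pos hσ t
  have hρ : 0 < ρ := by positivity
  have hρ1 : ρ ≤ 1 := min_le_left _ _
  have hρ2 : M * (4 * ρ) ≤ σ * σ ^ t := by
    have : ρ ≤ σ * σ ^ t / (4 * (M + 1)) := min_le_right _ _
    rw [le_div_iff₀ (by positivity)] at this
    nlinarith
  obtain ⟨F, hF, hdisj, hmass⟩ := select_balls c R T hR hcov h σ hσ ρ hρ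
  set B : ι × ℝ → Set ℝ := fun p => Metric.closedBall (c p.1) (R p.1) with hB
  set r : ι × ℝ → ℝ := fun p => R p.1 ^ (1 / t) with hr
  set b : ι × ℝ → Set ℝ := fun p => Metric.ball (c p.1) (r p) with hb
  set m : ι × ℝ → ℝ := fun p => μ.real (B p) with hm
  have hRpos : ∀ p ∈ F, 0 < R p.1 := fun p hp => hR _ (hF p hp).1
  have hrpos : ∀ p ∈ F, 0 < r p := fun p hp => Real.rpow_pos_of_pos (hRpos p hp) _
  have hrt : ∀ p ∈ F, r p ^ t = R p.1 := by
    intro p hp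
    simp only [hr]
    rw [← Real.rpow_mul (hRpos p hp).le, one_div_mul_cancel ht0.ne', Real.rpow_one]
  have hrR : ∀ p ∈ F, r p ≤ R p.1 := by
    intro p hp
    simp only [hr]
    calc R p.1 ^ (1 / t) ≤ R p.1 ^ (1:ℝ) := by
          apply Real.rpow_le_rpow_of_exponent_ge (hRpos p hp) ((hF p hp).2.1.trans hρ1)
          rw [le_div_iff₀ ht0]; linarith
      _ = _ := Real.rpow_one _
  have hm0 : ∀ p, 0 ≤ m p := fun p => measureReal_nonneg
  have hm2 : ∀ p ∈ F, m p ≤ 2 * M * R p.1 := by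
    intro p hp
    have := h.real_le (s := B p) measure_closedBall_lt_top.ne
    simp only [hB] at this
    rw [Real.volume_real_closedBall (hRpos p hp).le] at this
    simp only [hm, hB]; linarith
  have hbB : ∀ p ∈ F, b p ⊆ B p := fun p hp =>
    Metric.ball_subset_closedBall.trans (Metric.closedBall_subset_closedBall (hrR p hp))
  set ν : Measure ℝ := ∑ p ∈ F, ENNReal.ofReal (m p / (2 * r p)) • volume.restrict (b p) with hν
  have hbvol : ∀ p (A : Set ℝ), volume (A ∩ b p) ≠ ⊤ := fun p A =>
    ((measure_mono inter_subset_right).trans_lt measure_ball_lt_top).ne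
  have hνreal : ∀ A, MeasurableSet A → ν.real A = ∑ p ∈ F, m p / (2 * r p) * volume.real (A ∩ b p) := by
    intro A hA
    rw [measureReal_def, hν, Measure.finsetSum_apply, ENNReal.toReal_sum]
    · refine Finset.sum_congr rfl fun p hp => ?_
      rw [Measure.smul_apply, smul_eq_mul, ENNReal.toReal_mul, Measure.restrict_apply hA,
        ENNReal.toReal_ofReal (div_nonneg (hm0 p) (by linarith [hrpos p hp])), measureReal_def]
    · intro p hp
      rw [Measure.smul_apply, smul_eq_mul, Measure.restrict_apply hA]
      exact ENNReal.mul_ne_top ENNReal.ofReal_ne_top (hbvol p A)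
  -- single term estimates
  have hterm1 : ∀ p ∈ F, ∀ A, m p / (2 * r p) * volume.real (A ∩ b p) ≤ m p := by
    intro p hp A
    have h1 : volume.real (A ∩ b p) ≤ 2 * r p := by
      rw [← Real.volume_real_ball (a := c p.1) (hrpos p hp).le]
      exact measureReal_mono inter_subset_right measure_ball_lt_top.ne
    have h2 := hrpos p hp
    calc m p / (2 * r p) * volume.real (A ∩ b p) ≤ m p / (2 * r p) * (2 * r p) := by
          apply mul_le_mul_of_nonneg_left h1; have := hm0 p; positivity
      _ = m p := by field_simp
  have hterm2 : ∀ p ∈ F, ∀ u d, 0 < d →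
      m p / (2 * r p) * volume.real (Icc u (u + d) ∩ b p) ≤ 2 * M * d ^ t := by
    intro p hp u d hd
    have h2 := hrpos p hp
    rcases le_or_gt (r p) d with hrd | hrd
    · refine (hterm1 p hp _).trans ((hm2 p hp).trans ?_)
      apply mul_le_mul_of_nonneg_left _ (by linarith)
      rw [← hrt p hp]
      exact Real.rpow_le_rpow h2.le hrd ht0.le
    · have h1 : volume.real (Icc u (u + d) ∩ b p) ≤ d := by
        have : volume.real (Icc u (u + d)) = d := by
          rw [Real.volume_real_Icc_of_le (by linarith)]; ring
        refine le_trans ?_ this.le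
        exact measureReal_mono inter_subset_left (by simp)
      have h3 : m p / (2 * r p) ≤ M * (r p ^ t / r p) := by
        rw [div_le_iff₀ (by positivity)]
        have := hm2 p hp
        rw [hrt p hp]
        calc m p ≤ 2 * M * R p.1 := this
          _ = M * (R p.1 / r p) * (2 * r p) := by field_simp
      have h4 : r p ^ t / r p ≤ d ^ t / d := by
        rw [← Real.rpow_sub_one h2.ne', ← Real.rpow_sub_one hd.ne']
        exact Real.rpow_le_rpow_of_nonpos hd hrd.le (by linarith)
      have hdt : 0 < d ^ t := Real.rpow_pos_of_pos hd t
      calc m p / (2 * r p) * volume.real (Icc u (u + d) ∩ b p)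
          ≤ (M * (d ^ t / d)) * d := by
            apply mul_le_mul (h3.trans (mul_le_mul_of_nonneg_left h4 hM)) h1 measureReal_nonneg
            positivity
        _ = M * d ^ t := by field_simp
        _ ≤ 2 * M * d ^ t := by nlinarith [mul_nonneg hM hdt.le]
  -- many balls estimate
  have hmany : ∀ (G : Finset (ι × ℝ)), G ⊆ F → ∀ u v, u ≤ v → (∀ p ∈ G, B p ⊆ Icc u v) →
      ∑ p ∈ G, m p ≤ μ.real (Icc u v) := by
    intro G hG u v huv hsub
    have := measureReal_biUnion_finset (μ := μ) (s := G) (f := B)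
      (hdisj.subset (by exact_mod_cast hG)) (fun p _ => Metric.isClosed_closedBall.measurableSet)
    simp only [hm]
    rw [← this]
    apply measureReal_mono _ (measure_ne_top _ _)
    exact iUnion₂_subset hsub
  classical
  have hzero : ∀ p A, ¬ (A ∩ b p).Nonempty → m p / (2 * r p) * volume.real (A ∩ b p) = 0 := by
    intro p A hA
    rw [not_nonempty_iff_eq_empty.1 hA]; simp
  have hloc : ∀ p ∈ F, ∀ u d e, R p.1 ≤ e → (Icc u (u + d) ∩ b p).Nonempty →
      B p ⊆ Icc (u - 2 * e) (u + d + 2 * e) := by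
    rintro p hp u d e he ⟨z, hz1, hz2⟩ w hw
    have hz3 := hbB p hp hz2
    simp only [hB, Metric.mem_closedBall, Real.dist_eq, abs_le] at hz3 hw
    constructor <;> linarith [hz1.1, hz1.2]
  refine ⟨⋃ p ∈ F, b p, ∑ p ∈ F, m p / (2 * r p), ν, ?_, ?_, ?_, ?_, ?_, ?_⟩
  · have hsubV : (⋃ p ∈ F, b p) ⊆ V := iUnion₂_subset fun p hp => (hbB p hp).trans (hF p hp).2.2
    refine ⟨isOpen_biUnion fun p _ => Metric.isOpen_ball, hsubV.trans h.sub, ?_, ?_, ?_⟩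
    · rw [hν, Measure.finsetSum_apply]
      refine Finset.sum_eq_zero fun p hp => ?_
      rw [Measure.smul_apply, Measure.restrict_apply]
      · have : (⋃ p ∈ F, b p)ᶜ ∩ b p = ∅ := by
          rw [← disjoint_iff_inter_eq_empty, disjoint_compl_left_iff_subset]
          exact subset_biUnion_of_mem (u := fun p => b p) hp
        rw [this]; simp
      · exact (isOpen_biUnion fun p _ => Metric.isOpen_ball).measurableSet.compl
    · exact Finset.sum_nonneg fun p hp => div_nonneg (hm0 p) (by linarith [hrpos p hp])
    · intro A
      rw [hν, Measure.finsetSum_apply, ENNReal.ofReal_sum_of_nonneg, Finset.sum_mul]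
      · refine Finset.sum_le_sum fun p hp => ?_
        rw [Measure.smul_apply, smul_eq_mul]
        gcongr
        exact Measure.restrict_le_self
      · exact fun p hp => div_nonneg (hm0 p) (by linarith [hrpos p hp])
  · have : closure (⋃ p ∈ F, b p) ⊆ ⋃ p ∈ F, B p := by
      apply closure_minimal (iUnion₂_mono hbB)
      exact F.finite_toSet.isClosed_biUnion fun p _ => Metric.isClosed_closedBall
    exact this.trans (iUnion₂_subset fun p hp => (hF p hp).2.2)
  · have : closure (⋃ p ∈ F, b p) ⊆ ⋃ p ∈ F, Metric.closedBall (c p.1) (r p) := by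
      apply closure_minimal (iUnion₂_mono fun p hp => Metric.ball_subset_closedBall)
      exact F.finite_toSet.isClosed_biUnion fun p _ => Metric.isClosed_closedBall
    refine this.trans (iUnion₂_subset fun p hp => ?_)
    exact subset_biUnion_of_mem (u := fun i => Metric.closedBall (c i) (R i ^ (1 / t))) (hF p hp).1
  · refine hmass.trans ?_
    rw [hνreal _ MeasurableSet.univ]
    apply Finset.sum_le_sum
    intro p hp
    have h2 := hrpos p hp
    rw [univ_inter, Real.volume_real_ball h2.le]
    apply le_of_eq
    field_simp
    rfl
  · intro u d hσd hd1
    have hd : 0 < d := hσ.trans_le hσd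
    rw [hνreal _ measurableSet_Icc]
    have h1 : ∑ p ∈ F, m p / (2 * r p) * volume.real (Icc u (u + d) ∩ b p) ≤
        ∑ p ∈ F with (Icc u (u + d) ∩ b p).Nonempty, m p := by
      rw [Finset.sum_filter]
      refine Finset.sum_le_sum fun p hp => ?_
      split_ifs with hne
      · exact hterm1 p hp _
      · rw [hzero p _ hne]
    refine h1.trans ((hmany _ (Finset.filter_subset _ _) (u - 2 * ρ) (u + d + 2 * ρ)
      (by linarith) ?_).trans ?_)
    · intro p hp
      rw [Finset.mem_filter] at hp
      exact hloc p hp.1 u d ρ (hF p hp.1).2.1 hp.2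
    · have hsub : Icc (u - 2 * ρ) (u + d + 2 * ρ) ⊆
          (Icc u (u + d) ∪ Icc (u - 2 * ρ) u) ∪ Icc (u + d) (u + d + 2 * ρ) := by
        intro z hz
        rcases le_total z u with h1 | h1
        · exact Or.inl (Or.inr ⟨hz.1, h1⟩)
        · rcases le_total z (u + d) with h2 | h2
          · exact Or.inl (Or.inl ⟨h1, h2⟩)
          · exact Or.inr ⟨h2, hz.2⟩
      have e1 := measureReal_mono (μ := μ) hsub (measure_ne_top _ _)
      have e2 := measureReal_union_le (μ := μ) (Icc u (u + d) ∪ Icc (u - 2 * ρ) u)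
        (Icc (u + d) (u + d + 2 * ρ))
      have e3 := measureReal_union_le (μ := μ) (Icc u (u + d)) (Icc (u - 2 * ρ) u)
      have e4 := h.real_Icc_le (u := u - 2 * ρ) (v := u) (by linarith)
      have e5 := h.real_Icc_le (u := u + d) (v := u + d + 2 * ρ) (by linarith)
      have e6 : σ * σ ^ t ≤ σ * d ^ t :=
        mul_le_mul_of_nonneg_left (Real.rpow_le_rpow hσ.le hσd ht0.le) hσ.le
      nlinarith
  · intro u d hd hd1
    rw [hνreal _ measurableSet_Icc]
    have hdt : d ≤ d ^ t := by
      calc d = d ^ (1:ℝ) := (Real.rpow_one d).symm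
        _ ≤ d ^ t := Real.rpow_le_rpow_of_exponent_ge hd hd1 ht1.le
    have hsplit : ∑ p ∈ F, m p / (2 * r p) * volume.real (Icc u (u + d) ∩ b p) ≤
        (∑ p ∈ F with ((Icc u (u + d) ∩ b p).Nonempty ∧ R p.1 ≤ d), m p) +
        ∑ p ∈ F with ((Icc u (u + d) ∩ b p).Nonempty ∧ d < R p.1), 2 * M * d ^ t := by
      rw [Finset.sum_filter, Finset.sum_filter, ← Finset.sum_add_distrib]
      refine Finset.sum_le_sum fun p hp => ?_
      by_cases hne : (Icc u (u + d) ∩ b p).Nonempty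
      · rcases le_or_gt (R p.1) d with h1 | h1
        · simp only [hne, h1, not_lt.2 h1, and_self, and_false, if_true, if_false, add_zero]
          exact hterm1 p hp _
        · simp only [hne, h1, not_le.2 h1, and_self, and_false, if_true, if_false, zero_add]
          exact hterm2 p hp u d hd
      · simp [hne, hzero p _ hne]
    have hA : ∑ p ∈ F with ((Icc u (u + d) ∩ b p).Nonempty ∧ R p.1 ≤ d), m p ≤ 5 * M * d := by
      refine (hmany _ (Finset.filter_subset _ _) (u - 2 * d) (u + d + 2 * d)
        (by linarith) ?_).trans ?_
      · intro p hp
        rw [Finset.mem_filter] at hp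
        exact hloc p hp.1 u d d hp.2.2 hp.2.1
      · refine (h.real_Icc_le (by linarith)).trans (le_of_eq (by ring))
    have hcard : ∀ z : ℝ, (F.filter (fun p => z ∈ B p)).card ≤ 1 := by
      intro z
      rw [Finset.card_le_one]
      intro p hp q hq
      rw [Finset.mem_filter] at hp hq
      by_contra hpq
      exact (Set.disjoint_left.1 (hdisj hp.1 hq.1 hpq)) hp.2 hq.2
    have hC : (F.filter (fun p => (Icc u (u + d) ∩ b p).Nonempty ∧ d < R p.1)).card ≤ 2 := by
      have hsub : F.filter (fun p => (Icc u (u + d) ∩ b p).Nonempty ∧ d < R p.1) ⊆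
          F.filter (fun p => u ∈ B p) ∪ F.filter (fun p => u + d ∈ B p) := by
        intro p hp
        rw [Finset.mem_filter] at hp
        obtain ⟨hpF, ⟨z, hz1, hz2⟩, hdR⟩ := hp
        have hz3 := hbB p hpF hz2
        rw [Finset.mem_union, Finset.mem_filter, Finset.mem_filter]
        simp only [hB, Metric.mem_closedBall, Real.dist_eq, abs_le] at hz3 ⊢
        rcases le_total (c p.1) u with h1 | h1
        · exact Or.inl ⟨hpF, by constructor <;> linarith [hz1.1, hz1.2]⟩
        · rcases le_total (u + d) (c p.1) with h2 | h2
          · exact Or.inr ⟨hpF, by constructor <;> linarith [hz1.1, hz1.2]⟩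
          · exact Or.inl ⟨hpF, by constructor <;> linarith [hz1.1, hz1.2]⟩
      refine (Finset.card_le_card hsub).trans ((Finset.card_union_le _ _).trans ?_)
      have := hcard u
      have := hcard (u + d)
      omega
    rw [Finset.sum_const, nsmul_eq_mul] at hsplit
    have hC' : ((F.filter (fun p => (Icc u (u + d) ∩ b p).Nonempty ∧ d < R p.1)).card : ℝ) ≤ 2 := by
      exact_mod_cast hC
    have hMd : 0 ≤ 2 * M * d ^ t := by positivity
    have := mul_le_mul_of_nonneg_right hC' hMd
    have := mul_le_mul_of_nonneg_left hdt hM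
    linarith

lemma small_pow (t : ℝ) (ht1 : t < 1) (M ε : ℝ) (hM : 0 ≤ M) (hε : 0 < ε) :
    ∃ σ > 0, σ ≤ 1 ∧ ∀ d, 0 < d → d ≤ σ → M * d ≤ ε * d ^ t := by
  have hpos : 0 < ε / (M + 1) := by positivity
  refine ⟨min 1 ((ε / (M + 1)) ^ (1 / (1 - t))), by positivity, min_le_left _ _, ?_⟩
  intro d hd hdσ
  have h1 : d ^ (1 - t) ≤ ε / (M + 1) := by
    have := Real.rpow_le_rpow hd.le (hdσ.trans (min_le_right _ _)) (by linarith : 0 ≤ 1 - t)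
    rwa [← Real.rpow_mul hpos.le, one_div_mul_cancel (by linarith), Real.rpow_one] at this
  have h2 : d = d ^ (1 - t) * d ^ t := by
    rw [← Real.rpow_add hd]; simp
  have h3 : 0 < d ^ t := Real.rpow_pos_of_pos hd t
  have h4 : (M + 1) * d ^ (1 - t) ≤ ε := by
    rw [le_div_iff₀ (by positivity)] at h1; linarith
  have h5 : 0 < d ^ (1 - t) := Real.rpow_pos_of_pos hd _
  calc M * d = M * d ^ (1 - t) * d ^ t := by rw [mul_assoc, ← h2]
    _ ≤ ε * d ^ t := by
      apply mul_le_mul_of_nonneg_right _ h3.le; nlinarith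

/-- Sum of `m` layers. -/
lemma layers {ι : Type*} (c R : ι → ℝ) (T : Set ι) (hR : ∀ i ∈ T, 0 < R i)
    (t : ℝ) (ht0 : 0 < t) (ht1 : t < 1)
    (hcov : ∀ᵐ y : ℝ, y ∈ Ioo (0:ℝ) 1 → ∀ ε > 0, ∃ i ∈ T, R i ≤ ε ∧
      y ∈ Metric.closedBall (c i) (R i))
    {V : Set ℝ} {M : ℝ} {μ : Measure ℝ} (h : Carr V M μ) (ε : ℝ) (hε : 0 < ε) (m : ℕ) :
    ∃ V' M' μ', Carr V' M' μ' ∧ closure V' ⊆ V ∧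
      closure V' ⊆ ⋃ i ∈ T, Metric.closedBall (c i) (R i ^ (1 / t)) ∧
      m * (μ.real univ - ε) ≤ μ'.real univ ∧
      (∀ u d, 0 < d → d ≤ 1 → μ'.real (Icc u (u + d)) ≤
        m * μ.real (Icc u (u + d)) + (m * ε + 9 * M) * d ^ t) := by
  have hM := h.nonneg
  induction m with
  | zero =>
    refine ⟨∅, 0, 0, ⟨isOpen_empty, by simp, by simp, le_rfl, by simp⟩, by simp, by simp,
      by simp, ?_⟩
    intro u d hd hd1
    have := Real.rpow_pos_of_pos hd t
    simp; positivity
  | succ m ih =>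
    obtain ⟨V₁, M₁, μ₁, h₁, hc₁, hT₁, hmass₁, hU₁⟩ := ih
    obtain ⟨σ₀, hσ₀, hσ₀1, hσ₀d⟩ := small_pow t ht1 M₁ ε h₁.nonneg hε
    obtain ⟨V₂, M₂, μ₂, h₂, hc₂, hT₂, hmass₂, hU₂, hU₃⟩ := weak_step c R T hR t ht0 ht1 hcov h
      (min σ₀ ε) (by positivity)
    have := h₁.finite
    have := h₂.finite
    have hadd : ∀ A, (μ₁ + μ₂).real A = μ₁.real A + μ₂.real A := fun A => measureReal_add_apply
    refine ⟨V₁ ∪ V₂, M₁ + M₂, μ₁ + μ₂, ⟨h₁.isOpen.union h₂.isOpen, union_subset h₁.sub h₂.sub, ?_,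
      add_nonneg h₁.nonneg h₂.nonneg, ?_⟩, ?_, ?_, ?_, ?_⟩
    · rw [Measure.add_apply, measure_mono_null (compl_subset_compl.2 subset_union_left) h₁.null,
        measure_mono_null (compl_subset_compl.2 subset_union_right) h₂.null, add_zero]
    · intro s
      rw [Measure.add_apply, ENNReal.ofReal_add h₁.nonneg h₂.nonneg, add_mul]
      exact add_le_add (h₁.dens s) (h₂.dens s)
    · rw [closure_union]; exact union_subset hc₁ hc₂
    · rw [closure_union]; exact union_subset hT₁ hT₂
    · rw [hadd]
      have := min_le_right σ₀ ε
      push_cast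
      linarith
    · intro u d hd hd1
      rw [hadd]
      push_cast
      have hdt := Real.rpow_pos_of_pos hd t
      rcases le_or_gt (min σ₀ ε) d with hcase | hcase
      · have e1 := hU₁ u d hd hd1
        have e2 := hU₂ u d hcase hd1
        have e3 : min σ₀ ε * d ^ t ≤ ε * d ^ t :=
          mul_le_mul_of_nonneg_right (min_le_right _ _) hdt.le
        linarith
      · have e1 := hσ₀d d hd (hcase.le.trans (min_le_left _ _))
        have e2 := h₁.real_Icc_le (u := u) (v := u + d) (by linarith)
        have e3 := hU₃ u d hd hd1
        have e4 : 0 ≤ μ.real (Icc u (u + d)) := measureReal_nonneg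
        have e5 : 0 ≤ ((m : ℝ) + 1) * μ.real (Icc u (u + d)) := by positivity
        have e6 : 0 ≤ (m : ℝ) * ε * d ^ t := by positivity
        have e7 : M₁ * (u + d - u) = M₁ * d := by ring
        linarith

/-- The main step: nearly no loss. -/
lemma strong_step {ι : Type*} (c R : ι → ℝ) (T : Set ι) (hR : ∀ i ∈ T, 0 < R i)
    (t : ℝ) (ht0 : 0 < t) (ht1 : t < 1)
    (hcov : ∀ᵐ y : ℝ, y ∈ Ioo (0:ℝ) 1 → ∀ ε > 0, ∃ i ∈ T, R i ≤ ε ∧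
      y ∈ Metric.closedBall (c i) (R i))
    {V : Set ℝ} {M : ℝ} {μ : Measure ℝ} (h : Carr V M μ) (ε : ℝ) (hε : 0 < ε) :
    ∃ V' M' μ', Carr V' M' μ' ∧ closure V' ⊆ V ∧
      closure V' ⊆ ⋃ i ∈ T, Metric.closedBall (c i) (R i ^ (1 / t)) ∧
      μ.real univ - ε ≤ μ'.real univ ∧
      (∀ u d, 0 < d → d ≤ 1 → μ'.real (Icc u (u + d)) ≤
        μ.real (Icc u (u + d)) + ε * d ^ t) := by
  have hM := h.nonneg
  obtain ⟨m, hm⟩ := exists_nat_gt (9 * M / (ε / 2))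
  have hm0 : (0:ℝ) < m := lt_of_le_of_lt (by positivity) hm
  rw [div_lt_iff₀ (by positivity)] at hm
  obtain ⟨V₁, M₁, μ₁, h₁, hc₁, hT₁, hmass₁, hU₁⟩ := layers c R T hR t ht0 ht1 hcov h (ε / 2)
    (by positivity) m
  have hreal : ∀ A, (ENNReal.ofReal (1 / m) • μ₁).real A = 1 / m * μ₁.real A := by
    intro A
    rw [measureReal_ennreal_smul_apply, ENNReal.toReal_ofReal (by positivity)]
  refine ⟨V₁, 1 / m * M₁, ENNReal.ofReal (1 / m) • μ₁, ⟨h₁.isOpen, h₁.sub, ?_, ?_, ?_⟩, hc₁, hT₁,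
    ?_, ?_⟩
  · rw [Measure.smul_apply, h₁.null, smul_zero]
  · have := h₁.nonneg; positivity
  · intro s
    rw [Measure.smul_apply, smul_eq_mul, ENNReal.ofReal_mul (by positivity), mul_assoc]
    gcongr
    exact h₁.dens s
  · rw [hreal, one_div, inv_mul_eq_div, le_div_iff₀ hm0]
    have : 0 < (m : ℝ) * (ε / 2) := by positivity
    linarith
  · intro u d hd hd1
    rw [hreal, one_div, inv_mul_eq_div, div_le_iff₀ hm0]
    have hdt := Real.rpow_pos_of_pos hd t
    have := hU₁ u d hd hd1
    have : (m * (ε / 2) + 9 * M) * d ^ t ≤ (ε * m) * d ^ t := by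
      apply mul_le_mul_of_nonneg_right _ hdt.le; linarith
    linarith

/-- Cantor type subset with a mass distribution property. -/
lemma cantor {ι : Type*} (c R : ι → ℝ) (T : ℕ → Set ι) (hR : ∀ n, ∀ i ∈ T n, 0 < R i)
    (t : ℝ) (ht0 : 0 < t) (ht1 : t < 1)
    (hcov : ∀ n, ∀ᵐ y : ℝ, y ∈ Ioo (0:ℝ) 1 → ∀ ε > 0, ∃ i ∈ T n, R i ≤ ε ∧
      y ∈ Metric.closedBall (c i) (R i))
    (ε : ℝ) (hε : 0 < ε) (hε2 : ε ≤ 1 / 2) :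
    ∃ K : Set ℝ, IsCompact K ∧ K ⊆ {y | y ∈ Ioo (0:ℝ) 1 ∧
        ∀ n, ∃ i ∈ T n, y ∈ Metric.closedBall (c i) (R i ^ (1 / t))} ∧
      ∀ (F : Finset ℕ) (u d : ℕ → ℝ), (∀ n ∈ F, 0 < d n ∧ d n ≤ 1) →
        K ⊆ ⋃ n ∈ F, Ioo (u n) (u n + d n) → 1 / 2 ≤ ∑ n ∈ F, (d n + ε * d n ^ t) := by
  let St := {p : Set ℝ × ℝ × Measure ℝ // Carr p.1 p.2.1 p.2.2}
  have hstep : ∀ (n : ℕ) (p : St), ∃ q : St, closure q.1.1 ⊆ p.1.1 ∧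
      closure q.1.1 ⊆ ⋃ i ∈ T n, Metric.closedBall (c i) (R i ^ (1 / t)) ∧
      p.1.2.2.real univ - ε * (1 / 2) ^ (n + 1) ≤ q.1.2.2.real univ ∧
      (∀ u d, 0 < d → d ≤ 1 → q.1.2.2.real (Icc u (u + d)) ≤
        p.1.2.2.real (Icc u (u + d)) + ε * (1 / 2) ^ (n + 1) * d ^ t) := by
    intro n p
    obtain ⟨V₁, M₁, μ₁, h₁, h2⟩ := strong_step c R (T n) (hR n) t ht0 ht1 (hcov n) p.2
      (ε * (1 / 2) ^ (n + 1)) (by positivity)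
    exact ⟨⟨(V₁, M₁, μ₁), h₁⟩, h2⟩
  choose f hf1 hf2 hf3 hf4 using hstep
  let p0 : St := ⟨(Ioo 0 1, 1, volume.restrict (Ioo 0 1)),
    ⟨isOpen_Ioo, subset_rfl, by simp [Measure.restrict_apply measurableSet_Ioo.compl], zero_le_one,
      fun s => by simpa using measure_mono inter_subset_left⟩⟩
  let P : ℕ → St := fun n => Nat.rec p0 (fun n p => f n p) n
  have hP0 : P 0 = p0 := rfl
  have hPs : ∀ n, P (n + 1) = f n (P n) := fun n => rfl
  have hmass : ∀ n, 1 - ε * (1 - (1 / 2) ^ n) ≤ (P n).1.2.2.real univ := by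
    intro n
    induction n with
    | zero => simp [hP0, p0, measureReal_def]
    | succ n ih =>
      rw [hPs]
      have := hf3 n (P n)
      rw [pow_succ] at *
      linarith
  have hbound : ∀ n u d, 0 < d → d ≤ 1 → (P n).1.2.2.real (Icc u (u + d)) ≤
      d + ε * (1 - (1 / 2) ^ n) * d ^ t := by
    intro n u d hd hd1
    induction n with
    | zero =>
      have := p0.2.real_Icc_le (u := u) (v := u + d) (by linarith)
      rw [hP0]
      simp only [p0] at this ⊢
      simp only [pow_zero, sub_self, mul_zero, zero_mul, add_zero]
      linarith
    | succ n ih =>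
      rw [hPs]
      have := hf4 n (P n) u d hd hd1
      rw [pow_succ] at *
      linarith
  set C : ℕ → Set ℝ := fun n => closure (P (n + 1)).1.1 with hC
  have hCsub : ∀ n, C n ⊆ (P n).1.1 := fun n => hf1 n (P n)
  have hCanti : ∀ n, C (n + 1) ⊆ C n := fun n => (hCsub (n + 1)).trans subset_closure
  have hC01 : ∀ n, C n ⊆ Icc 0 1 := fun n => (hCsub n).trans ((P n).2.sub.trans Ioo_subset_Icc_self)
  have hCcomp : ∀ n, IsCompact (C n) := fun n =>
    isCompact_Icc.of_isClosed_subset isClosed_closure (hC01 n)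
  refine ⟨⋂ n, C n, (hCcomp 0).of_isClosed_subset
    (isClosed_iInter fun n => isClosed_closure) (iInter_subset _ 0), ?_, ?_⟩
  · intro y hy
    rw [mem_iInter] at hy
    refine ⟨(P 0).2.sub (hCsub 0 (hy 0)), fun n => ?_⟩
    have := hf2 n (P n) (hy n)
    simpa using this
  · intro F u d hd hK
    have hopen : IsOpen (⋃ n ∈ F, Ioo (u n) (u n + d n)) := isOpen_biUnion fun n _ => isOpen_Ioo
    have hdir : Directed (· ⊇ ·) C :=
      (antitone_nat_of_succ_le hCanti).directed_ge
    obtain ⟨N, hN⟩ := exists_subset_nhds_of_isCompact' hdir hCcomp (fun n => isClosed_closure)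
      (U := ⋃ n ∈ F, Ioo (u n) (u n + d n)) (fun x hx => hopen.mem_nhds (hK hx))
    have := (P (N + 1)).2.finite
    have h1 : (P (N + 1)).1.2.2.real univ ≤
        (P (N + 1)).1.2.2.real (⋃ n ∈ F, Icc (u n) (u n + d n)) := by
      rw [measureReal_def, measureReal_def]
      apply ENNReal.toReal_mono (measure_ne_top _ _)
      rw [← union_compl_self (P (N + 1)).1.1]
      refine (measure_union_le _ _).trans ?_
      rw [(P (N + 1)).2.null, add_zero]
      apply measure_mono
      refine subset_closure.trans (hN.trans ?_)
      exact iUnion₂_mono fun n _ => Ioo_subset_Icc_self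
    have h2 := measureReal_biUnion_finset_le (μ := (P (N + 1)).1.2.2) F
      (fun n => Icc (u n) (u n + d n))
    have h3 : ∑ n ∈ F, (P (N + 1)).1.2.2.real (Icc (u n) (u n + d n)) ≤
        ∑ n ∈ F, (d n + ε * d n ^ t) := by
      refine Finset.sum_le_sum fun n hn => ?_
      have e1 := hbound (N + 1) (u n) (d n) (hd n hn).1 (hd n hn).2
      have e2 := Real.rpow_pos_of_pos (hd n hn).1 t
      have e3 : 0 ≤ ε * (1 / 2) ^ (N + 1) * d n ^ t := by positivity
      nlinarith
    have h4 := hmass (N + 1)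
    have h5 : 0 ≤ ε * (1 / 2) ^ (N + 1) := by positivity
    linarith

/-- One dimensional mass transference principle. -/
lemma mtp_one {ι : Type*} (c R : ι → ℝ) (T : ℕ → Set ι) (hR : ∀ n, ∀ i ∈ T n, 0 < R i)
    (t : ℝ) (ht0 : 0 < t) (ht1 : t < 1)
    (hcov : ∀ n, ∀ᵐ y : ℝ, y ∈ Ioo (0:ℝ) 1 → ∀ ε > 0, ∃ i ∈ T n, R i ≤ ε ∧
      y ∈ Metric.closedBall (c i) (R i)) :
    μH[t] {y | y ∈ Ioo (0:ℝ) 1 ∧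
        ∀ n, ∃ i ∈ T n, y ∈ Metric.closedBall (c i) (R i ^ (1 / t))} = ⊤ := by
  set E := {y | y ∈ Ioo (0:ℝ) 1 ∧
        ∀ n, ∃ i ∈ T n, y ∈ Metric.closedBall (c i) (R i ^ (1 / t))} with hE
  have key : ∀ ε : ℝ, 0 < ε → ε ≤ 1 / 2 → ENNReal.ofReal (1 / (8 * ε) - 1) ≤ μH[t] E := by
    intro ε hε hε2
    obtain ⟨K, hKc, hKE, hK⟩ := cantor c R T hR t ht0 ht1 hcov ε hε hε2
    refine le_trans ?_ (measure_mono hKE)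
    obtain ⟨σ, hσ, hσ1, hσd⟩ := small_pow t ht1 1 ε zero_le_one hε
    rw [Measure.hausdorffMeasure_apply]
    refine le_trans ?_ (le_iSup₂ (ENNReal.ofReal (σ / 4)) (by simpa using hσ))
    refine le_iInf fun A => le_iInf fun hKA => le_iInf fun hdiam => ?_
    have hsup : ∀ n, (⨆ (_ : (A n).Nonempty), Metric.ediam (A n) ^ t) = Metric.ediam (A n) ^ t := by
      intro n
      by_cases hn : (A n).Nonempty
      · simp [hn]
      · rw [not_nonempty_iff_eq_empty] at hn
        simp [hn, ht0]
    simp_rw [hsup]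
    by_cases htop : ∑' n, Metric.ediam (A n) ^ t = ⊤
    · rw [htop]; exact le_top
    obtain ⟨e, he0, hesum⟩ := ENNReal.exists_pos_sum_of_countable (ε := 1) one_ne_zero ℕ
    -- real diameters
    set D : ℕ → ℝ := fun n => (Metric.ediam (A n)).toReal with hD
    have hDfin : ∀ n, Metric.ediam (A n) ≠ ⊤ := fun n =>
      ((hdiam n).trans_lt ENNReal.ofReal_lt_top).ne
    have hD0 : ∀ n, 0 ≤ D n := fun n => ENNReal.toReal_nonneg
    have hDσ : ∀ n, D n ≤ σ / 4 := fun n => ENNReal.toReal_le_of_le_ofReal (by linarith) (hdiam n)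
    set ξ : ℕ → ℝ := fun n => min ((e n : ℝ) ^ (1 / t)) (σ / 4) with hξ
    have hξ0 : ∀ n, 0 < ξ n := fun n => by
      have : (0:ℝ) < e n := he0 n
      simp only [hξ]; positivity
    have hξσ : ∀ n, ξ n ≤ σ / 4 := fun n => min_le_right _ _
    have hξe : ∀ n, ξ n ^ t ≤ e n := fun n => by
      have h1 : (0:ℝ) < e n := he0 n
      have := Real.rpow_le_rpow (hξ0 n).le (min_le_left ((e n : ℝ) ^ (1 / t)) (σ / 4)) ht0.le
      rwa [← Real.rpow_mul h1.le, one_div_mul_cancel ht0.ne', Real.rpow_one] at this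
    have hpt : ∀ n, ∃ x, A n ⊆ Metric.closedBall x (D n) := by
      intro n
      by_cases hn : (A n).Nonempty
      · obtain ⟨x, hx⟩ := hn
        refine ⟨x, fun y hy => ?_⟩
        rw [Metric.mem_closedBall, dist_edist]
        exact ENNReal.toReal_mono (hDfin n) (Metric.edist_le_ediam_of_mem hy hx)
      · rw [not_nonempty_iff_eq_empty] at hn
        exact ⟨0, by simp [hn]⟩
    choose x hx using hpt
    set d : ℕ → ℝ := fun n => 2 * (D n + ξ n) with hd
    set u : ℕ → ℝ := fun n => x n - (D n + ξ n) with hu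
    have hd0 : ∀ n, 0 < d n := fun n => by
      have := hξ0 n; have := hD0 n; simp only [hd]; linarith
    have hdσ : ∀ n, d n ≤ σ := fun n => by
      have := hξσ n; have := hDσ n; simp only [hd]; linarith
    have hcover : K ⊆ ⋃ n, Ioo (u n) (u n + d n) := by
      refine hKA.trans (iUnion_mono fun n => (hx n).trans ?_)
      intro y hy
      rw [Metric.mem_closedBall, Real.dist_eq, abs_le] at hy
      have := hξ0 n
      simp only [hu, hd]
      constructor <;> linarith [hy.1, hy.2]
    obtain ⟨F, hF⟩ := hKc.elim_finite_subcover _ (fun n => isOpen_Ioo) hcover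
    have hmain := hK F u d (fun n _ => ⟨hd0 n, (hdσ n).trans hσ1⟩) hF
    have hterm : ∀ n, d n + ε * d n ^ t ≤ 4 * ε * (D n ^ t + e n) := by
      intro n
      have h1 := hσd (d n) (hd0 n) (hdσ n)
      have h2 : d n ^ t ≤ 2 * (D n ^ t + e n) := by
        simp only [hd]
        rw [Real.mul_rpow (by norm_num) (by have := hξ0 n; have := hD0 n; linarith)]
        have h3 : (2:ℝ) ^ t ≤ 2 := by
          calc (2:ℝ) ^ t ≤ 2 ^ (1:ℝ) := Real.rpow_le_rpow_of_exponent_le (by norm_num) ht1.le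
            _ = 2 := Real.rpow_one 2
        have h4 : (D n + ξ n) ^ t ≤ D n ^ t + ξ n ^ t :=
          Real.rpow_add_le_add_rpow (hD0 n) (hξ0 n).le ht0.le ht1.le
        have h5 := hξe n
        have h6 : 0 ≤ (D n + ξ n) ^ t := Real.rpow_nonneg (by have := hξ0 n; have := hD0 n; linarith) t
        calc (2:ℝ) ^ t * (D n + ξ n) ^ t ≤ 2 * (D n + ξ n) ^ t := by
              apply mul_le_mul_of_nonneg_right h3 h6
          _ ≤ 2 * (D n ^ t + e n) := by linarith
      nlinarith
    have hsum1 : 1 / 2 ≤ 4 * ε * (∑ n ∈ F, D n ^ t + ∑ n ∈ F, (e n : ℝ)) := by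
      refine hmain.trans ((Finset.sum_le_sum fun n _ => hterm n).trans (le_of_eq ?_))
      rw [← Finset.mul_sum, Finset.sum_add_distrib]
    have hesum1 : ∑ n ∈ F, (e n : ℝ) ≤ 1 := by
      have : ∑ n ∈ F, (e n : ℝ≥0∞) ≤ 1 := (ENNReal.sum_le_tsum F).trans hesum.le
      exact_mod_cast this
    have hDsum : ENNReal.ofReal (∑ n ∈ F, D n ^ t) ≤ ∑' n, Metric.ediam (A n) ^ t := by
      refine le_trans (le_of_eq ?_) (ENNReal.sum_le_tsum F)
      rw [ENNReal.ofReal_sum_of_nonneg (fun n _ => Real.rpow_nonneg (hD0 n) t)]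
      refine Finset.sum_congr rfl fun n _ => ?_
      rw [← ENNReal.ofReal_rpow_of_nonneg (hD0 n) ht0.le, ENNReal.ofReal_toReal (hDfin n)]
    refine le_trans (ENNReal.ofReal_le_ofReal ?_) hDsum
    have h8 : 1 / (8 * ε) ≤ ∑ n ∈ F, D n ^ t + ∑ n ∈ F, (e n : ℝ) := by
      rw [div_le_iff₀ (by positivity)]; linarith
    linarith
  apply ENNReal.eq_top_of_forall_nnreal_le
  intro r
  refine le_trans ?_ (key (1 / (8 * (r + 4))) (by positivity) ?_)
  · rw [← ENNReal.ofReal_coe_nnreal]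
    apply ENNReal.ofReal_le_ofReal
    have : (0:ℝ) ≤ r := r.2
    rw [show (1:ℝ) / (8 * (1 / (8 * (r + 4)))) = r + 4 by field_simp]
    linarith
  · have : (0:ℝ) ≤ r := r.2
    apply one_div_le_one_div_of_le <;> linarith

/-- Slicing inequality: almost all slices of a set of finite `(1+t)`-measure have finite
`t`-measure. -/
lemma slice_finite (t : ℝ) (ht0 : 0 < t) (A : Set (EuclideanSpace ℝ (Fin 2)))
    (hA : μH[1 + t] A ≠ ⊤) :
    ∀ᵐ x : ℝ, μH[t] {y : ℝ | (!₂[x, y] : EuclideanSpace ℝ (Fin 2)) ∈ A} < ⊤ := by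
  set L : ℝ≥0∞ := μH[1 + t] A + 1 with hL
  have hLtop : L ≠ ⊤ := by simp [hL, hA]
  have hcov : ∀ n : ℕ, ∃ U : ℕ → Set (EuclideanSpace ℝ (Fin 2)), A ⊆ ⋃ i, U i ∧
      (∀ i, Metric.ediam (U i) ≤ ((n : ℝ≥0∞) + 1)⁻¹) ∧ ∑' i, Metric.ediam (U i) ^ (1 + t) ≤ L := by
    intro n
    have h1 : μH[1 + t] A < L := ENNReal.lt_add_right hA one_ne_zero
    rw [Measure.hausdorffMeasure_apply] at h1
    have h2 := (le_iSup₂ (f := fun (r : ℝ≥0∞) (_ : 0 < r) =>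
      ⨅ (U : ℕ → Set (EuclideanSpace ℝ (Fin 2))) (_ : A ⊆ ⋃ n, U n)
        (_ : ∀ n, Metric.ediam (U n) ≤ r), ∑' n, ⨆ (_ : (U n).Nonempty), Metric.ediam (U n) ^ (1 + t))
      (((n : ℝ≥0∞) + 1)⁻¹) (by simp)).trans_lt h1
    simp only [iInf_lt_iff] at h2
    obtain ⟨U, hU1, hU2, hU3⟩ := h2
    refine ⟨U, hU1, hU2, ?_⟩
    refine le_trans (le_of_eq ?_) hU3.le
    refine tsum_congr fun i => ?_
    by_cases hn : (U i).Nonempty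
    · simp [hn]
    · rw [not_nonempty_iff_eq_empty] at hn
      simp [hn, (by linarith : 0 < 1 + t)]
  choose U hU1 hU2 hU3 using hcov
  have hfin : ∀ n i, Metric.ediam (U n i) ≠ ⊤ := fun n i =>
    ((hU2 n i).trans_lt (by simp)).ne
  have hI : ∀ n i, ∃ I : Set ℝ, MeasurableSet I ∧ (∀ z ∈ U n i, z 0 ∈ I) ∧
      volume I ≤ 2 * Metric.ediam (U n i) := by
    intro n i
    by_cases hn : (U n i).Nonempty
    · obtain ⟨z, hz⟩ := hn
      refine ⟨Metric.closedBall (z 0) (Metric.ediam (U n i)).toReal,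
        Metric.isClosed_closedBall.measurableSet, fun w hw => ?_, ?_⟩
      · rw [Metric.mem_closedBall]
        refine le_trans (b := dist w z) ?_ ?_
        · rw [EuclideanSpace.dist_eq, Fin.sum_univ_two]
          apply Real.le_sqrt_of_sq_le
          nlinarith [sq_nonneg (dist (w 1) (z 1))]
        · rw [dist_edist]
          exact ENNReal.toReal_mono (hfin n i) (Metric.edist_le_ediam_of_mem hw hz)
      · rw [Real.volume_closedBall, ENNReal.ofReal_mul (by norm_num),
          ENNReal.ofReal_toReal (hfin n i)]
        simp
    · rw [not_nonempty_iff_eq_empty] at hn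
      exact ⟨∅, MeasurableSet.empty, by simp [hn], by simp⟩
  choose I hI1 hI2 hI3 using hI
  set g : ℕ → ℝ → ℝ≥0∞ := fun n x =>
    ∑' i, (I n i).indicator (fun _ => Metric.ediam (U n i) ^ t) x with hg
  have hgm : ∀ n, Measurable (g n) := fun n =>
    Measurable.ennreal_tsum fun i => measurable_const.indicator (hI1 n i)
  have hgint : ∀ n, ∫⁻ x, g n x ≤ 2 * L := by
    intro n
    simp only [hg]
    rw [lintegral_tsum (fun i => (measurable_const.indicator (hI1 n i)).aemeasurable)]
    refine le_trans ?_ (mul_le_mul_right (hU3 n) 2)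
    rw [← ENNReal.tsum_mul_left]
    refine ENNReal.tsum_le_tsum fun i => ?_
    rw [lintegral_indicator_const (hI1 n i)]
    rw [ENNReal.rpow_add_of_nonneg _ _ zero_le_one ht0.le, ENNReal.rpow_one]
    calc Metric.ediam (U n i) ^ t * volume (I n i)
        ≤ Metric.ediam (U n i) ^ t * (2 * Metric.ediam (U n i)) := by
          gcongr; exact hI3 n i
      _ = _ := by ring
  have hlim : ∫⁻ x, liminf (fun n => g n x) atTop ≤ 2 * L := by
    refine (lintegral_liminf_le hgm).trans ?_
    refine (liminf_le_liminf (Eventually.of_forall hgint)).trans ?_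
    simp
  have hae : ∀ᵐ x : ℝ, liminf (fun n => g n x) atTop < ⊤ := by
    apply ae_lt_top (Measurable.liminf hgm)
    exact (hlim.trans_lt (ENNReal.mul_lt_top (by simp) hLtop.lt_top)).ne
  filter_upwards [hae] with x hx
  refine lt_of_le_of_lt ?_ hx
  have hsl : ∀ n i, Metric.ediam {y : ℝ | (!₂[x, y] : EuclideanSpace ℝ (Fin 2)) ∈ U n i} ≤
      Metric.ediam (U n i) := by
    intro n i
    apply Metric.ediam_le
    intro y hy y' hy'
    refine le_trans (le_of_eq ?_) (Metric.edist_le_ediam_of_mem hy hy')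
    rw [edist_dist, edist_dist, EuclideanSpace.dist_eq, Fin.sum_univ_two]
    simp
  have htend : Tendsto (fun n : ℕ => ((n : ℝ≥0∞) + 1)⁻¹) atTop (nhds 0) := by
    have := (tendsto_add_atTop_iff_nat 1).2 ENNReal.tendsto_inv_nat_nhds_zero
    simpa using this
  refine (Measure.hausdorffMeasure_le_liminf_tsum (ι := fun _ : ℕ => ℕ) t _ _ htend
    (fun n i => {y : ℝ | (!₂[x, y] : EuclideanSpace ℝ (Fin 2)) ∈ U n i})
    (Eventually.of_forall fun n i => (hsl n i).trans (hU2 n i))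
    (Eventually.of_forall fun n y hy => ?_)).trans ?_
  · have := hU1 n hy
    simpa using this
  · refine liminf_le_liminf (Eventually.of_forall fun n => ?_)
    refine ENNReal.tsum_le_tsum fun i => ?_
    by_cases hxI : x ∈ I n i
    · simp only [hxI, indicator_of_mem]
      exact ENNReal.rpow_le_rpow (hsl n i) ht0.le
    · have : {y : ℝ | (!₂[x, y] : EuclideanSpace ℝ (Fin 2)) ∈ U n i} = ∅ := by
        rw [eq_empty_iff_forall_notMem]
        intro y hy
        exact hxI (by simpa using hI2 n i _ hy)
      rw [this]
      simp [ht0]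

/-- Borel-Cantelli for Hausdorff measures. -/
lemma hausdorff_bc {X ι : Type*} [EMetricSpace X] [MeasurableSpace X] [BorelSpace X] [Countable ι]
    (s : ℝ) (hs : 0 < s) (U : ι → Set X) (hU : ∑' i, Metric.ediam (U i) ^ s ≠ ⊤) :
    μH[s] {x | {i | x ∈ U i}.Infinite} = 0 := by
  have h0 := ENNReal.tendsto_tsum_compl_atTop_zero hU
  have hr : Tendsto (fun F : Finset ι => (∑' b : { x // x ∉ F }, Metric.ediam (U b) ^ s) ^ (1 / s))
      atTop (nhds 0) := by
    have := (ENNReal.continuous_rpow_const (y := 1 / s)).tendsto (0 : ℝ≥0∞)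
    rw [ENNReal.zero_rpow_of_pos (by positivity)] at this
    exact this.comp h0
  refine le_antisymm ?_ bot_le
  refine (Measure.hausdorffMeasure_le_liminf_tsum (ι := fun F : Finset ι => { x // x ∉ F }) s _ _ hr
    (fun F i => U i) (Eventually.of_forall fun F i => ?_)
    (Eventually.of_forall fun F x hx => ?_)).trans (le_of_eq h0.liminf_eq)
  · have h1 : Metric.ediam (U i) ^ s ≤ ∑' b : { x // x ∉ F }, Metric.ediam (U b) ^ s :=
      ENNReal.le_tsum (f := fun b : { x // x ∉ F } => Metric.ediam (U b) ^ s) i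
    have := ENNReal.rpow_le_rpow h1 (by positivity : 0 ≤ 1 / s)
    rwa [← ENNReal.rpow_mul, mul_one_div_cancel hs.ne', ENNReal.rpow_one] at this
  · obtain ⟨i, hi, hiF⟩ := Set.Infinite.exists_notMem_finset hx F
    exact mem_iUnion.2 ⟨⟨i, hiF⟩, hi⟩

/-- The height of an integer vector. -/
def ht (a : Fin 2 → ℤ) : ℕ := max (a 0).natAbs (a 1).natAbs

lemma ht_count (n : ℕ) (hn : 1 ≤ n) : ({a | ht a = n} : Set (Fin 2 → ℤ)).encard ≤ 12 * n := by
  classical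
  set I : Finset ℤ := Finset.Icc (-(n:ℤ)) n with hI
  set E : Finset ℤ := {(n:ℤ), -(n:ℤ)} with hE
  have hsub : ({a | ht a = n} : Set (Fin 2 → ℤ)) ⊆
      (fun q : ℤ × ℤ => (![q.1, q.2] : Fin 2 → ℤ)) '' ((E ×ˢ I ∪ I ×ˢ E : Finset (ℤ × ℤ)) : Set (ℤ × ℤ)) := by
    intro a ha
    refine ⟨(a 0, a 1), ?_, ?_⟩
    · have ha' : max (a 0).natAbs (a 1).natAbs = n := ha
      simp only [hE, hI, Finset.coe_union, mem_union, Finset.mem_coe, Finset.mem_product,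
        Finset.mem_insert, Finset.mem_singleton, Finset.mem_Icc]
      omega
    · ext i; fin_cases i <;> rfl
  refine (encard_le_encard hsub).trans ((encard_image_le _ _).trans ?_)
  rw [encard_coe_eq_coe_finsetCard]
  have h1 : (E ×ˢ I ∪ I ×ˢ E : Finset (ℤ × ℤ)).card ≤ 12 * n := by
    refine (Finset.card_union_le _ _).trans ?_
    rw [Finset.card_product, Finset.card_product]
    have e1 : E.card ≤ 2 := Finset.card_le_two
    have e2 : I.card = 2 * n + 1 := by simp [hI]; omega
    rw [e2]
    nlinarith
  exact_mod_cast h1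

lemma tsum_ht (f : ℕ → ℝ≥0∞) (h0 : f 0 = 0) :
    ∑' a : Fin 2 → ℤ, f (ht a) ≤ ∑' n : ℕ, 12 * ((n + 1 : ℕ) : ℝ≥0∞) * f (n + 1) := by
  have h1 : ∀ a : Fin 2 → ℤ, f (ht a) = ∑' n : ℕ, ({a | ht a = n} : Set (Fin 2 → ℤ)).indicator
      (fun _ => f n) a := by
    intro a
    rw [tsum_eq_single (ht a)]
    · simp [indicator]
    · intro b hb
      simp [indicator, hb.symm]
  simp_rw [h1]
  rw [ENNReal.tsum_comm, tsum_eq_zero_add' ENNReal.summable]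
  simp only [h0, indicator_zero, tsum_zero, zero_add]
  refine ENNReal.tsum_le_tsum fun n => ?_
  rw [← tsum_subtype, ENNReal.tsum_const, ENat.card_coe_set_eq]
  gcongr
  have := ht_count (n + 1) (by omega)
  calc ((({a | ht a = n + 1} : Set (Fin 2 → ℤ)).encard : ℕ∞) : ℝ≥0∞)
      ≤ (((12 * (n + 1 : ℕ) : ℕ∞)) : ℝ≥0∞) := by exact_mod_cast this
    _ = _ := by push_cast; rfl

lemma dist_le_two (x y : EuclideanSpace ℝ (Fin 2)) : dist x y ≤ |x 0 - y 0| + |x 1 - y 1| := by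
  rw [EuclideanSpace.dist_eq, Fin.sum_univ_two, Real.dist_eq, Real.dist_eq]
  apply Real.sqrt_le_iff.2
  constructor
  · positivity
  · nlinarith [abs_nonneg (x 0 - y 0), abs_nonneg (x 1 - y 1)]

/-- The coordinate used to cut a strip into cells. -/
def cutc (a : Fin 2 → ℤ) : Fin 2 := if (a 0).natAbs ≤ (a 1).natAbs then 0 else 1

/-- A cell of a strip. -/
def cell (ψ : ℝ → ℝ) (a : Fin 2 → ℤ) (p : ℤ) (l : ℕ) : Set (EuclideanSpace ℝ (Fin 2)) :=
  {x | x ∈ box2 ∧ |(a 0 : ℝ) ^ 2 * x 0 + (a 1 : ℝ) ^ 2 * x 1 - (p : ℝ) ^ 2| < ψ (ht a) ∧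
    l * (ψ (ht a) / (ht a : ℝ) ^ 2) ≤ x (cutc a) ∧
    x (cutc a) < (l + 1) * (ψ (ht a) / (ht a : ℝ) ^ 2)}

lemma cell_diam_aux (A B w ρ q x y x' y' : ℝ) (l : ℕ) (hA : 0 < A) (hB : 0 ≤ B) (hBA : B ≤ A)
    (hρ : ρ = w / A)
    (h1 : |B * x + A * y - q| < w) (h2 : |B * x' + A * y' - q| < w)
    (h3 : l * ρ ≤ x) (h4 : x < (l + 1) * ρ) (h5 : l * ρ ≤ x') (h6 : x' < (l + 1) * ρ) :
    |x - x'| + |y - y'| ≤ 4 * ρ := by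
  have hw : w = A * ρ := by rw [hρ]; field_simp
  have hρ0 : 0 ≤ ρ := by linarith
  have e1 : |x - x'| ≤ ρ := by rw [abs_le]; constructor <;> linarith
  have e2 : |y - y'| ≤ 3 * ρ := by
    rw [abs_lt] at h1 h2
    have e3 : |B * (x - x')| ≤ A * ρ := by
      rw [abs_mul, abs_of_nonneg hB]
      exact mul_le_mul hBA e1 (abs_nonneg _) hA.le
    rw [abs_le] at e3
    rw [abs_le]
    constructor
    · by_contra hc
      push Not at hc
      have := mul_lt_mul_of_pos_left hc hA
      nlinarith
    · by_contra hc
      push Not at hc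
      have := mul_lt_mul_of_pos_left hc hA
      nlinarith
  linarith

lemma sq_natAbs (z : ℤ) : (z : ℝ) ^ 2 = (z.natAbs : ℝ) ^ 2 := by
  rw [← sq_abs (z : ℝ)]
  congr 1
  rw [Nat.cast_natAbs]; push_cast; rfl

lemma cell_diam (ψ : ℝ → ℝ) (a : Fin 2 → ℤ) (hh : 1 ≤ ht a) (p : ℤ) (l : ℕ) :
    Metric.ediam (cell ψ a p l) ≤ ENNReal.ofReal (4 * (ψ (ht a) / (ht a : ℝ) ^ 2)) := by
  apply Metric.ediam_le
  intro x hx y hy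
  rw [edist_dist]
  apply ENNReal.ofReal_le_ofReal
  refine (dist_le_two x y).trans ?_
  obtain ⟨-, hx1, hx2, hx3⟩ := hx
  obtain ⟨-, hy1, hy2, hy3⟩ := hy
  rw [sq_natAbs (a 0), sq_natAbs (a 1)] at hx1 hy1
  have hpos : (0:ℝ) < (ht a : ℝ) ^ 2 := by
    have : (0:ℝ) < ht a := by exact_mod_cast hh
    positivity
  by_cases hc : (a 0).natAbs ≤ (a 1).natAbs
  · have hcut : cutc a = 0 := by simp [cutc, hc]
    have hht : (a 1).natAbs = ht a := by simp [ht, hc]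
    rw [hcut] at hx2 hx3 hy2 hy3
    refine cell_diam_aux ((ht a : ℝ) ^ 2) (((a 0).natAbs : ℝ) ^ 2) (ψ (ht a)) _ ((p:ℝ) ^ 2) _ _ _ _ l hpos
      (by positivity) ?_ rfl ?_ ?_ hx2 hx3 hy2 hy3
    · rw [← hht]; gcongr
    · rwa [hht] at hx1
    · rwa [hht] at hy1
  · have hcut : cutc a = 1 := by simp [cutc, hc]
    have hht : (a 0).natAbs = ht a := by simp [ht]; omega
    rw [hcut] at hx2 hx3 hy2 hy3
    rw [add_comm |x 0 - y 0|]
    refine cell_diam_aux ((ht a : ℝ) ^ 2) (((a 1).natAbs : ℝ) ^ 2) (ψ (ht a)) _ ((p:ℝ) ^ 2) _ _ _ _ l hpos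
      (by positivity) ?_ rfl ?_ ?_ hx2 hx3 hy2 hy3
    · rw [← hht]; gcongr; omega
    · rw [hht] at hx1; rwa [add_comm] at hx1
    · rw [hht] at hy1; rwa [add_comm] at hy1

/-- Bound for `p` when the strip meets the box. -/
lemma p_bound (C : ℝ) (a : Fin 2 → ℤ) (hh : 1 ≤ ht a) (p : ℤ) (w : ℝ) (hw : w ≤ C) (hC : 0 ≤ C)
    (x : EuclideanSpace ℝ (Fin 2)) (hx : x ∈ box2)
    (h : |(a 0 : ℝ) ^ 2 * x 0 + (a 1 : ℝ) ^ 2 * x 1 - (p : ℝ) ^ 2| < w) :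
    |(p : ℝ)| ≤ (2 + C) * ht a := by
  have h1 : (1:ℝ) ≤ ht a := by exact_mod_cast hh
  have e0 : (a 0 : ℝ) ^ 2 ≤ (ht a : ℝ) ^ 2 := by
    rw [sq_natAbs]; gcongr; simp [ht]
  have e1 : (a 1 : ℝ) ^ 2 ≤ (ht a : ℝ) ^ 2 := by
    rw [sq_natAbs]; gcongr; simp [ht]
  have x0 := hx 0
  have x1 := hx 1
  have f0 : (a 0 : ℝ) ^ 2 * x 0 ≤ (ht a : ℝ) ^ 2 := by
    nlinarith [x0.1, x0.2, sq_nonneg (a 0 : ℝ)]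
  have f1 : (a 1 : ℝ) ^ 2 * x 1 ≤ (ht a : ℝ) ^ 2 := by
    nlinarith [x1.1, x1.2, sq_nonneg (a 1 : ℝ)]
  rw [abs_lt] at h
  have e2 : (p : ℝ) ^ 2 ≤ 2 * (ht a : ℝ) ^ 2 + C := by linarith
  apply abs_le_of_sq_le_sq _ (by positivity)
  have e3 : (1:ℝ) ≤ (ht a : ℝ) ^ 2 := by nlinarith
  have e4 : (2 + C) * (ht a : ℝ) ^ 2 ≤ ((2 + C) * ht a) ^ 2 := by
    rw [mul_pow]; apply mul_le_mul_of_nonneg_right _ (by positivity); nlinarith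
  nlinarith

lemma cell_sum (ψ : ℝ → ℝ) (hψ0 : ∀ h, 0 ≤ ψ h) (hanti : AntitoneOn ψ (Set.Ici 0))
    (s : ℝ) (hs1 : 1 < s) (a : Fin 2 → ℤ) (hh : 1 ≤ ht a) :
    ∑' q : ℤ × ℕ, Metric.ediam (cell ψ a q.1 q.2) ^ s ≤
      ENNReal.ofReal ((5 + 2 * ψ 0) * (1 + ψ 0) * 4 ^ s) *
        ENNReal.ofReal (ψ (ht a) ^ (s - 1) * (ht a : ℝ) ^ (3 - 2 * s)) := by
  classical
  have h1 : (1:ℝ) ≤ ht a := by exact_mod_cast hh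
  have hC := hψ0 0
  have hψC : ψ (ht a) ≤ ψ 0 := hanti (by simp) (by simp) (by positivity)
  rcases (hψ0 (ht a)).eq_or_lt with hz | hpos
  · have : ∀ q : ℤ × ℕ, cell ψ a q.1 q.2 = ∅ := by
      intro q
      rw [eq_empty_iff_forall_notMem]
      rintro x ⟨-, hx, -⟩
      rw [← hz] at hx
      exact absurd (abs_nonneg _) (not_le.2 hx)
    simp [this, (by linarith : 0 < s)]
  set ρ : ℝ := ψ (ht a) / (ht a : ℝ) ^ 2 with hρ
  have hρ0 : 0 < ρ := by positivity
  have hρC : ρ ≤ ψ 0 := by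
    rw [hρ, div_le_iff₀ (by positivity)]
    have h2 : (1:ℝ) ≤ (ht a : ℝ) ^ 2 := by nlinarith
    nlinarith [mul_le_mul_of_nonneg_left h2 hC]
  set P : ℕ := ⌊(2 + ψ 0) * ht a⌋₊ with hP
  set Λ : ℕ := ⌊1 / ρ⌋₊ + 1 with hΛ
  set G : Finset (ℤ × ℕ) := Finset.Icc (-(P:ℤ)) P ×ˢ Finset.range Λ with hG
  have hout : ∀ q ∉ G, Metric.ediam (cell ψ a q.1 q.2) ^ s = 0 := by
    intro q hq
    suffices h : cell ψ a q.1 q.2 = ∅ by simp [h, (by linarith : 0 < s)]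
    rw [eq_empty_iff_forall_notMem]
    rintro x ⟨hxb, hx1, hx2, hx3⟩
    apply hq
    rw [hG, Finset.mem_product, Finset.mem_Icc, Finset.mem_range]
    have hp := p_bound (ψ 0) a hh q.1 _ hψC hC x hxb hx1
    have hp' : q.1.natAbs ≤ P := by
      rw [hP, Nat.le_floor_iff (by positivity)]
      rw [Nat.cast_natAbs]; push_cast; exact hp
    refine ⟨by omega, ?_⟩
    rw [hΛ, Nat.lt_add_one_iff, Nat.le_floor_iff (by positivity), le_div_iff₀ hρ0]
    exact hx2.trans (hxb _).2.le
  rw [tsum_eq_sum hout]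
  have hcard : (G.card : ℝ) ≤ (5 + 2 * ψ 0) * ht a * ((1 + ψ 0) / ρ) := by
    rw [hG, Finset.card_product, Finset.card_range]
    have e1 : (Finset.Icc (-(P:ℤ)) P).card = 2 * P + 1 := by simp; omega
    rw [e1]
    push_cast
    have e2 : (P : ℝ) ≤ (2 + ψ 0) * ht a := Nat.floor_le (by positivity)
    have e3 : (⌊1 / ρ⌋₊ : ℝ) ≤ 1 / ρ := Nat.floor_le (by positivity)
    have e4 : (Λ : ℝ) ≤ (1 + ψ 0) / ρ := by
      rw [hΛ]; push_cast
      rw [add_div]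
      have : 1 ≤ ψ 0 / ρ := by rw [le_div_iff₀ hρ0]; linarith
      linarith
    apply mul_le_mul _ e4 (by positivity) (by positivity)
    nlinarith
  calc ∑ q ∈ G, Metric.ediam (cell ψ a q.1 q.2) ^ s ≤ ∑ q ∈ G, ENNReal.ofReal ((4 * ρ) ^ s) := by
        refine Finset.sum_le_sum fun q _ => ?_
        rw [← ENNReal.ofReal_rpow_of_pos (by positivity)]
        exact ENNReal.rpow_le_rpow (cell_diam ψ a hh q.1 q.2) (by linarith)
    _ = ENNReal.ofReal (G.card * (4 * ρ) ^ s) := by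
        rw [Finset.sum_const, nsmul_eq_mul, ENNReal.ofReal_mul (by positivity), ENNReal.ofReal_natCast]
    _ ≤ ENNReal.ofReal (((5 + 2 * ψ 0) * (1 + ψ 0) * 4 ^ s) * (ψ (ht a) ^ (s - 1) * (ht a : ℝ) ^ (3 - 2 * s))) := by
        apply ENNReal.ofReal_le_ofReal
        refine (mul_le_mul_of_nonneg_right hcard (by positivity)).trans (le_of_eq ?_)
        have r1 : ρ ^ s = ρ ^ (s - 1) * ρ := by
          rw [← Real.rpow_add_one hρ0.ne']; congr 1; ring
        have r2 : ρ ^ (s - 1) = ψ (ht a) ^ (s - 1) * (ht a : ℝ) ^ (2 - 2 * s) := by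
          rw [hρ, Real.div_rpow hpos.le (by positivity), ← Real.rpow_natCast, ← Real.rpow_mul (by positivity),
            div_eq_mul_inv, ← Real.rpow_neg (by positivity)]
          congr 2; push_cast; ring
        have r3 : (ht a : ℝ) ^ (3 - 2 * s) = (ht a : ℝ) ^ (2 - 2 * s) * ht a := by
          rw [← Real.rpow_add_one (by positivity)]; congr 1; ring
        rw [Real.mul_rpow (by norm_num) hρ0.le, r1, r2, r3]
        field_simp
    _ = _ := by rw [ENNReal.ofReal_mul (by positivity)]

lemma conv_part (ψ : ℝ → ℝ) (hψ0 : ∀ h, 0 ≤ ψ h) (hanti : AntitoneOn ψ (Set.Ici 0))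
    (s : ℝ) (hs1 : 1 < s)
    (hsum : ∑' h : ℕ,
        ENNReal.ofReal (ψ ((h : ℝ) + 1) ^ (s - 1) * ((h : ℝ) + 1) ^ (4 - 2 * s)) ≠ ⊤) :
    μH[s] (S2 ψ) = 0 := by
  refine measure_mono_null ?_ (hausdorff_bc s (by linarith)
    (fun i : (Fin 2 → ℤ) × (ℤ × ℕ) => {x | 1 ≤ ht i.1 ∧ x ∈ cell ψ i.1 i.2.1 i.2.2}) ?_)
  · rintro x ⟨hxb, hinf⟩
    set Q : Set ((Fin 2 → ℤ) × ℤ) := {q |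
      |(q.1 0 : ℝ) ^ 2 * x 0 + (q.1 1 : ℝ) ^ 2 * x 1 - (q.2 : ℝ) ^ 2| <
        ψ ((max (q.1 0).natAbs (q.1 1).natAbs : ℕ) : ℝ)} with hQ
    have hfin : {q ∈ Q | ¬ 1 ≤ ht q.1}.Finite := by
      obtain ⟨N, hN⟩ := exists_nat_gt (ψ 0)
      refine ((Set.finite_Icc (-(N:ℤ)) N).image (fun p => ((0 : Fin 2 → ℤ), p))).subset ?_
      rintro ⟨a, p⟩ ⟨hq, h0⟩
      have h0' : max (a 0).natAbs (a 1).natAbs = 0 := by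
        have : ¬ 1 ≤ max (a 0).natAbs (a 1).natAbs := h0
        omega
      have a0 : a 0 = 0 := by omega
      have a1 : a 1 = 0 := by omega
      refine ⟨p, ?_, ?_⟩
      · have hq' : |(a 0 : ℝ) ^ 2 * x 0 + (a 1 : ℝ) ^ 2 * x 1 - (p : ℝ) ^ 2| <
          ψ ((max (a 0).natAbs (a 1).natAbs : ℕ) : ℝ) := hq
        rw [h0', a0, a1] at hq'
        simp only [Int.cast_zero, ne_eq, OfNat.ofNat_ne_zero, not_false_eq_true, zero_pow, zero_mul,
          add_zero, zero_sub, abs_neg, Nat.cast_zero] at hq'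
        have h3 : (p : ℝ) ^ 2 < N := (le_abs_self _).trans_lt (hq'.trans hN)
        have h4 : p ^ 2 < N := by exact_mod_cast h3
        constructor <;> nlinarith
      · simp only [Prod.mk.injEq, and_true]
        ext i; fin_cases i
        · exact a0.symm
        · exact a1.symm
    have hinf' : {q ∈ Q | 1 ≤ ht q.1}.Infinite := by
      intro hf
      apply hinf
      refine (hf.union hfin).subset ?_
      intro q hq
      by_cases h : 1 ≤ ht q.1
      · exact Or.inl ⟨hq, h⟩
      · exact Or.inr ⟨hq, h⟩
    refine ((hinf'.image (f := fun q => ((q.1, (q.2, ⌊x (cutc q.1) / (ψ (ht q.1) / (ht q.1 : ℝ) ^ 2)⌋₊)) :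
      (Fin 2 → ℤ) × (ℤ × ℕ))) ?_)).mono ?_
    · intro q _ q' _ he
      simp only [Prod.mk.injEq] at he
      exact Prod.ext he.1 he.2.1
    · rintro _ ⟨q, ⟨hq, hq1⟩, rfl⟩
      have hq' : |(q.1 0 : ℝ) ^ 2 * x 0 + (q.1 1 : ℝ) ^ 2 * x 1 - (q.2 : ℝ) ^ 2| < ψ (ht q.1) := hq
      have hpos : 0 < ψ (ht q.1) := (abs_nonneg _).trans_lt hq'
      have h1 : (1:ℝ) ≤ ht q.1 := by exact_mod_cast hq1
      have hρ : 0 < ψ (ht q.1) / (ht q.1 : ℝ) ^ 2 := by positivity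
      refine ⟨hq1, hxb, hq', ?_, ?_⟩
      · rw [← le_div_iff₀ hρ]
        exact Nat.floor_le (div_nonneg (hxb _).1 hρ.le)
      · rw [← div_lt_iff₀ hρ]
        exact Nat.lt_floor_add_one _
  · set K : ℝ≥0∞ := ENNReal.ofReal ((5 + 2 * ψ 0) * (1 + ψ 0) * 4 ^ s) with hK
    set f : ℕ → ℝ≥0∞ := fun n => if n = 0 then 0 else
      K * ENNReal.ofReal (ψ n ^ (s - 1) * (n : ℝ) ^ (3 - 2 * s)) with hf
    rw [ENNReal.tsum_prod' ]
    have hle : ∑' (a : Fin 2 → ℤ), ∑' (b : ℤ × ℕ),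
        Metric.ediam {x | 1 ≤ ht a ∧ x ∈ cell ψ a b.1 b.2} ^ s ≤ ∑' a : Fin 2 → ℤ, f (ht a) := by
      refine ENNReal.tsum_le_tsum fun a => ?_
      by_cases h : 1 ≤ ht a
      · simp only [h, true_and]
        have : ht a ≠ 0 := by omega
        simp only [hf, this, if_false]
        exact cell_sum ψ hψ0 hanti s hs1 a h
      · simp [h, (by linarith : 0 < s)]
    refine ne_top_of_le_ne_top ?_ (hle.trans (tsum_ht f (by simp [hf])))
    have : ∀ n : ℕ, 12 * ((n + 1 : ℕ) : ℝ≥0∞) * f (n + 1) = (12 * K) *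
        ENNReal.ofReal (ψ ((n : ℝ) + 1) ^ (s - 1) * ((n : ℝ) + 1) ^ (4 - 2 * s)) := by
      intro n
      have hn : (0:ℝ) < (n:ℝ) + 1 := by positivity
      simp only [hf, Nat.succ_ne_zero, if_false, Nat.cast_add, Nat.cast_one]
      have e1 : ((n:ℝ) + 1) ^ (4 - 2 * s) = ((n:ℝ) + 1) ^ (3 - 2 * s) * ((n:ℝ) + 1) := by
        rw [← Real.rpow_add_one hn.ne']; congr 1; ring
      have e2 : ((n : ℝ≥0∞) + 1) = ENNReal.ofReal ((n:ℝ) + 1) := by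
        rw [ENNReal.ofReal_add (by positivity) zero_le_one]; simp
      have e3 : 0 ≤ ψ ((n:ℝ) + 1) ^ (s - 1) * ((n:ℝ) + 1) ^ (3 - 2 * s) := by
        have := hψ0 (n + 1); positivity
      rw [e1, ← mul_assoc (ψ ((n:ℝ) + 1) ^ (s - 1)), ENNReal.ofReal_mul e3, e2]
      ring
    simp_rw [this]
    rw [ENNReal.tsum_mul_left]
    exact ENNReal.mul_ne_top (ENNReal.mul_ne_top (by simp) ENNReal.ofReal_ne_top) hsum


lemma tel_aux (u v : ℝ) (hu : 1 ≤ u) (huv : u ≤ v) :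
    (v ^ 4 - u ^ 4) / v ^ 4 * (1 / v) ≤ 4 * (1 / u - 1 / v) := by
  have hu0 : 0 < u := by linarith
  have hv0 : 0 < v := by linarith
  have e1 : 4 * (1 / u - 1 / v) = 4 * (v - u) / (u * v) := by field_simp
  have e2 : (v ^ 4 - u ^ 4) / v ^ 4 * (1 / v) = (v ^ 4 - u ^ 4) / v ^ 5 := by field_simp
  rw [e1, e2, div_le_div_iff₀ (by positivity) (by positivity)]
  have e3 : v ^ 4 - u ^ 4 ≤ (v - u) * (4 * v ^ 3) := by
    have : v ^ 4 - u ^ 4 = (v - u) * ((v + u) * (v ^ 2 + u ^ 2)) := by ring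
    rw [this]
    apply mul_le_mul_of_nonneg_left _ (by linarith)
    have h1 : v + u ≤ 2 * v := by linarith
    have h2 : v ^ 2 + u ^ 2 ≤ 2 * v ^ 2 := by nlinarith
    calc (v + u) * (v ^ 2 + u ^ 2) ≤ (2 * v) * (2 * v ^ 2) :=
          mul_le_mul h1 h2 (by positivity) (by positivity)
      _ = 4 * v ^ 3 := by ring
  calc (v ^ 4 - u ^ 4) * (u * v) ≤ ((v - u) * (4 * v ^ 3)) * (v * v) := by
        apply mul_le_mul e3 _ (by positivity)
        · have : 0 ≤ v - u := by linarith
          positivity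
        · nlinarith
    _ = 4 * (v - u) * v ^ 5 := by ring

lemma seq_choice (x : ℕ → ℝ) (hx : ∀ k, 0 ≤ x k) (hdiv : ¬ Summable x) :
    ∃ d ε : ℕ → ℝ, (∀ k, 0 < ε k ∧ ε k ≤ 1) ∧ (∀ k, 0 ≤ d k ∧ d k ≤ 1) ∧
      (∀ k, d k ≤ x k * ε k ^ 2) ∧ ¬ Summable d ∧ Summable (fun k => d k * √(ε k)) ∧
      Tendsto (fun k => ε k * 2 ^ k) atTop atTop ∧ ∀ k, 1 ≤ 2 * (ε k * 2 ^ k) := by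
  set e : ℕ → ℝ := fun k => min 1 (x k) with he
  have e0 : ∀ k, 0 ≤ e k := fun k => le_min zero_le_one (hx k)
  have e1 : ∀ k, e k ≤ 1 := fun k => min_le_left _ _
  have hediv : ¬ Summable e := by
    intro hs
    apply hdiv
    have h1 : ∀ᶠ k in atTop, e k < 1 := hs.tendsto_atTop_zero.eventually (gt_mem_nhds one_pos)
    refine hs.congr_atTop ?_
    filter_upwards [h1] with k hk
    simp only [he] at hk ⊢
    rcases min_lt_iff.1 hk with h | h
    · exact absurd h (lt_irrefl _)
    · exact min_eq_right h.le
  set S : ℕ → ℝ := fun k => 1 + ∑ i ∈ Finset.range k, e i with hS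
  have hS1 : ∀ k, 1 ≤ S k := fun k => by
    have : 0 ≤ ∑ i ∈ Finset.range k, e i := Finset.sum_nonneg fun i _ => e0 i
    simp only [hS]; linarith
  have hS0 : ∀ k, 0 < S k := fun k => by linarith [hS1 k]
  have hSs : ∀ k, S (k + 1) = S k + e k := fun k => by
    simp only [hS, Finset.sum_range_succ]; ring
  have hSle : ∀ k : ℕ, S k ≤ k + 1 := by
    intro k
    induction k with
    | zero => simp [hS]
    | succ k ih => rw [hSs]; push_cast; linarith [e1 k]
  have hSinf : Tendsto S atTop atTop := by
    apply tendsto_atTop_add_const_left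
    exact (not_summable_iff_tendsto_nat_atTop_of_nonneg e0).1 hediv
  have hεsq : ∀ k, (1 / √(S (k + 1))) ^ 2 = 1 / S (k + 1) := fun k => by
    rw [div_pow, Real.sq_sqrt (hS0 _).le, one_pow]
  have hsq1 : ∀ k, 1 ≤ √(S k) := fun k => Real.one_le_sqrt.2 (hS1 k)
  have hk2 : ∀ k : ℕ, √(S (k + 1)) ≤ √(k + 2) := fun k => by
    apply Real.sqrt_le_sqrt
    have := hSle (k + 1)
    push_cast at this
    linarith
  refine ⟨fun k => e k / S (k + 1), fun k => 1 / √(S (k + 1)), ?_, ?_, ?_, ?_, ?_, ?_, ?_⟩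
  · intro k
    have := hsq1 (k + 1)
    refine ⟨by positivity, ?_⟩
    rw [div_le_one (by linarith)]; exact this
  · intro k
    refine ⟨div_nonneg (e0 k) (hS0 _).le, ?_⟩
    rw [div_le_one (hS0 _)]
    linarith [e1 k, hS1 (k + 1)]
  · intro k
    simp only [hεsq]
    rw [mul_one_div]
    apply div_le_div_of_nonneg_right _ (hS0 _).le
    exact min_le_right _ _
  · intro hs
    have hlog : ∀ n, Real.log (S n) ≤ 2 * ∑ k ∈ Finset.range n, e k / S (k + 1) := by
      intro n
      induction n with
      | zero => simp [hS]
      | succ n ih =>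
        rw [Finset.sum_range_succ, mul_add]
        have h1 : Real.log (S (n + 1)) - Real.log (S n) = Real.log (S (n + 1) / S n) := by
          rw [Real.log_div (hS0 _).ne' (hS0 _).ne']
        have h2 : Real.log (S (n + 1) / S n) ≤ S (n + 1) / S n - 1 :=
          Real.log_le_sub_one_of_pos (div_pos (hS0 _) (hS0 _))
        have h3 : S (n + 1) / S n - 1 ≤ 2 * (e n / S (n + 1)) := by
          have : S (n + 1) / S n - 1 = e n / S n := by
            rw [hSs]; field_simp [(hS0 n).ne']; ring
          rw [this, ← mul_div_assoc, div_le_div_iff₀ (hS0 _) (hS0 _), hSs]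
          nlinarith [e0 n, e1 n, hS1 n, mul_nonneg (e0 n) (by linarith [e1 n, hS1 n] : 0 ≤ S n - e n)]
        linarith
    have hbd : ∀ n, Real.log (S n) ≤ 2 * ∑' k, e k / S (k + 1) := fun n => by
      refine (hlog n).trans ?_
      have := hs.sum_le_tsum (Finset.range n) (fun k _ => div_nonneg (e0 k) (hS0 (k + 1)).le)
      linarith
    have := (Real.tendsto_log_atTop.comp hSinf).eventually (eventually_gt_atTop (2 * ∑' k, e k / S (k + 1)))
    obtain ⟨n, hn⟩ := this.exists
    exact absurd (hbd n) (not_le.2 hn)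
  · apply summable_of_sum_range_le (c := 4)
    · intro k
      exact mul_nonneg (div_nonneg (e0 k) (hS0 _).le) (Real.sqrt_nonneg _)
    · intro n
      have hv : ∀ k, √(√(S k)) ^ 4 = S k := fun k => by
        rw [show 4 = 2 * 2 by norm_num, pow_mul, Real.sq_sqrt (Real.sqrt_nonneg _), Real.sq_sqrt (hS0 k).le]
      have hv1 : ∀ k, 1 ≤ √(√(S k)) := fun k => Real.one_le_sqrt.2 (hsq1 k)
      have hstep : ∀ k, e k / S (k + 1) * √(1 / √(S (k + 1))) ≤
          4 * (1 / √(√(S k)) - 1 / √(√(S (k + 1)))) := by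
        intro k
        have h := tel_aux (√(√(S k))) (√(√(S (k + 1)))) (hv1 k)
          (Real.sqrt_le_sqrt (Real.sqrt_le_sqrt (by rw [hSs]; linarith [e0 k])))
        rw [hv, hv] at h
        rw [Real.sqrt_div zero_le_one, Real.sqrt_one]
        have : S (k + 1) - S k = e k := by rw [hSs]; ring
        rwa [this] at h
      calc ∑ k ∈ Finset.range n, e k / S (k + 1) * √(1 / √(S (k + 1)))
          ≤ ∑ k ∈ Finset.range n, 4 * (1 / √(√(S k)) - 1 / √(√(S (k + 1)))) :=
            Finset.sum_le_sum fun k _ => hstep k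
        _ = 4 * (1 / √(√(S 0)) - 1 / √(√(S n))) := by
            rw [← Finset.mul_sum, Finset.sum_range_sub']
        _ ≤ 4 := by
            have h0 : S 0 = 1 := by simp [hS]
            rw [h0, Real.sqrt_one, Real.sqrt_one]
            have : 0 ≤ 1 / √(√(S n)) := by positivity
            linarith
  · have h1 : ∀ k : ℕ, √((k:ℝ) + 2) / 2 ≤ 1 / √(S (k + 1)) * 2 ^ k := by
      intro k
      have h3 : ((k:ℝ) + 1) ≤ 2 ^ k := by
        have := Nat.lt_two_pow_self (n := k)
        exact_mod_cast this
      have h4 := hsq1 (k + 1)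
      have h5 : √((k:ℝ) + 2) * √((k:ℝ) + 2) = k + 2 := Real.mul_self_sqrt (by positivity)
      rw [one_div, inv_mul_eq_div, div_le_div_iff₀ (by norm_num) (by linarith)]
      have h6 := mul_le_mul_of_nonneg_left (hk2 k) (Real.sqrt_nonneg ((k:ℝ) + 2))
      have h7 : (0:ℝ) ≤ k := by positivity
      linarith
    refine tendsto_atTop_mono h1 ?_
    apply Tendsto.atTop_div_const (by norm_num)
    exact Real.tendsto_sqrt_atTop.comp
      (tendsto_atTop_add_const_right _ _ tendsto_natCast_atTop_atTop)
  · intro k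
    have h2 : √(S (k + 1)) ≤ 2 * 2 ^ k := by
      refine (hk2 k).trans ?_
      rw [Real.sqrt_le_left (by positivity)]
      have h3 : ((k:ℝ) + 1) ≤ 2 ^ k := by
        have := Nat.lt_two_pow_self (n := k)
        exact_mod_cast this
      have h4 : (1:ℝ) ≤ 2 ^ k := one_le_pow₀ (by norm_num)
      nlinarith
    have := hsq1 (k + 1)
    simp only
    rw [one_div, ← mul_assoc, mul_right_comm, ← div_eq_mul_inv, le_div_iff₀ (by linarith)]
    linarith


lemma cond_div (ψ : ℝ → ℝ) (hψ0 : ∀ h, 0 ≤ ψ h) (hanti : AntitoneOn ψ (Set.Ici 0))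
    (t α : ℝ) (ht0 : 0 < t) (hα : 0 ≤ α)
    (hsum : ∑' h : ℕ, ENNReal.ofReal (ψ ((h : ℝ) + 1) ^ t * ((h : ℝ) + 1) ^ α) = ⊤) :
    ¬ Summable (fun k : ℕ => 2 ^ k * (((2:ℝ) ^ k) ^ α * ψ (2 ^ k) ^ t)) := by
  intro hs
  set x : ℕ → ℝ := fun k : ℕ => 2 ^ k * (((2:ℝ) ^ k) ^ α * ψ (2 ^ k) ^ t) with hx
  have x0 : ∀ k, 0 ≤ x k := fun k => by have := hψ0 (2 ^ k); positivity
  set f : ℕ → ℝ := fun h => ψ (h : ℝ) ^ t * (h : ℝ) ^ α with hf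
  have f0 : ∀ h, 0 ≤ f h := fun h => by have := hψ0 h; positivity
  have hblock : ∀ k, ∑ h ∈ Finset.Ico (2 ^ k) (2 ^ (k + 1)), f h ≤ 2 ^ α * x k := by
    intro k
    have : ∀ h ∈ Finset.Ico (2 ^ k) (2 ^ (k + 1)), f h ≤ 2 ^ α * (((2:ℝ) ^ k) ^ α * ψ (2 ^ k) ^ t) := by
      intro h hh
      rw [Finset.mem_Ico] at hh
      have h1 : (2:ℝ) ^ k ≤ h := by exact_mod_cast hh.1
      have h2 : (h:ℝ) ≤ 2 * 2 ^ k := by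
        have := hh.2.le
        rw [pow_succ, mul_comm] at this
        exact_mod_cast this
      have h3 : ψ h ≤ ψ (2 ^ k) := hanti (by simp) (by simp) h1
      simp only [hf]
      calc ψ h ^ t * (h:ℝ) ^ α ≤ ψ (2 ^ k) ^ t * (2 * 2 ^ k) ^ α := by
            apply mul_le_mul (Real.rpow_le_rpow (hψ0 _) h3 ht0.le)
              (Real.rpow_le_rpow (by positivity) h2 hα) (by positivity)
            exact Real.rpow_nonneg (hψ0 _) _
        _ = _ := by rw [Real.mul_rpow (by norm_num) (by positivity)]; ring
    refine (Finset.sum_le_card_nsmul _ _ _ this).trans (le_of_eq ?_)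
    have hc : 2 ^ (k + 1) - 2 ^ k = 2 ^ k := by rw [pow_succ]; omega
    rw [Nat.card_Ico, hc, nsmul_eq_mul]
    simp only [hx]
    push_cast; ring
  have hpart : ∀ n, ∑ h ∈ Finset.Ico 1 (2 ^ n), f h ≤ 2 ^ α * ∑ k ∈ Finset.range n, x k := by
    intro n
    induction n with
    | zero => simp
    | succ n ih =>
      rw [← Finset.sum_Ico_consecutive _ (Nat.one_le_two_pow : 1 ≤ 2 ^ n)
        (Nat.pow_le_pow_right (by norm_num) (Nat.le_succ n)), Finset.sum_range_succ, mul_add]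
      exact add_le_add ih (hblock n)
  have hsf : Summable (fun h : ℕ => f (h + 1)) := by
    apply summable_of_sum_range_le (c := 2 ^ α * ∑' k, x k) (fun h => f0 _)
    intro n
    have h1 : ∑ i ∈ Finset.range n, f (i + 1) = ∑ h ∈ Finset.Ico 1 (n + 1), f h := by
      rw [Finset.sum_Ico_eq_sum_range]
      simp [add_comm]
    rw [h1]
    calc ∑ h ∈ Finset.Ico 1 (n + 1), f h ≤ ∑ h ∈ Finset.Ico 1 (2 ^ (n + 1)), f h := by
          apply Finset.sum_le_sum_of_subset_of_nonneg
          · exact Finset.Ico_subset_Ico_right (Nat.lt_two_pow_self).le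
          · intro i _ _; exact f0 i
      _ ≤ 2 ^ α * ∑ k ∈ Finset.range (n + 1), x k := hpart _
      _ ≤ 2 ^ α * ∑' k, x k := by
          gcongr
          exact hs.sum_le_tsum _ fun k _ => x0 k
  have : ∑' h : ℕ, ENNReal.ofReal (f (h + 1)) ≠ ⊤ := by
    rw [← ENNReal.ofReal_tsum_of_nonneg (fun h => f0 _) hsf]
    exact ENNReal.ofReal_ne_top
  apply this
  rw [← hsum]
  simp [hf]

/-- A strip. -/
def Str (w : ℝ) (a : Fin 2 → ℤ) (p : ℤ) : Set (EuclideanSpace ℝ (Fin 2)) :=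
  {x | x ∈ box2 ∧ |(a 0 : ℝ) ^ 2 * x 0 + (a 1 : ℝ) ^ 2 * x 1 - (p : ℝ) ^ 2| < w}

lemma fin_box (M : ℕ) : {q : (Fin 2 → ℤ) × ℤ | ht q.1 ≤ M ∧ |(q.2 : ℝ)| ≤ M}.Finite := by
  refine ((Set.finite_Icc (fun _ : Fin 2 => -(M:ℤ)) (fun _ => (M:ℤ))).prod
    (Set.finite_Icc (-(M:ℤ)) M)).subset ?_
  rintro ⟨a, p⟩ ⟨h1, h2⟩
  have h1' : max (a 0).natAbs (a 1).natAbs ≤ M := h1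
  have h2' : |p| ≤ (M:ℤ) := by exact_mod_cast h2
  rw [abs_le] at h2'
  refine ⟨⟨?_, ?_⟩, h2'⟩
  · intro i; fin_cases i
    · show -(M:ℤ) ≤ a 0
      omega
    · show -(M:ℤ) ≤ a 1
      omega
  · intro i; fin_cases i
    · show a 0 ≤ (M:ℤ)
      omega
    · show a 1 ≤ (M:ℤ)
      omega

lemma full_levels (D : ℕ → ℝ) (hD0 : ∀ k, 0 ≤ D k) (hD1 : ∀ k, D k ≤ 1 / 2 ^ k)
    (hdiv : ¬ Summable (fun k => 2 ^ k * D k))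
    (bdkl : ∀ ψ' : ℝ → ℝ, (∀ h, 0 ≤ ψ' h) →
      (MonotoneOn ψ' (Set.Ici 0) ∨ AntitoneOn ψ' (Set.Ici 0)) →
      Tendsto ψ' atTop (nhds 0) →
      (∑' h : ℕ, ENNReal.ofReal (ψ' ((h : ℝ) + 1)) = ⊤) →
      volume (box2 \ S2 ψ') = 0) :
    volume (box2 \ {x | ∃ᶠ k in atTop, ∃ a p, 1 ≤ ht a ∧ ht a ≤ 2 ^ k ∧ x ∈ Str (D k) a p}) = 0 := by
  classical
  set F : ℝ → ℕ → ℝ := fun h k => if h ≤ 2 ^ k then D k else 0 with hF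
  have F0 : ∀ h k, 0 ≤ F h k := fun h k => by
    simp only [hF]; split_ifs; exacts [hD0 k, le_rfl]
  have F1 : ∀ h k, F h k ≤ 1 := fun h k => by
    simp only [hF]; split_ifs
    · refine (hD1 k).trans ?_
      rw [div_le_one (by positivity)]; exact one_le_pow₀ (by norm_num)
    · exact zero_le_one
  have Fb : ∀ h, BddAbove (range (F h)) := fun h => ⟨1, by rintro _ ⟨k, rfl⟩; exact F1 h k⟩
  set φ : ℝ → ℝ := fun h => ⨆ k, F h k with hφ
  have φ0 : ∀ h, 0 ≤ φ h := fun h => Real.iSup_nonneg (F0 h)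
  have φ1 : ∀ h, φ h ≤ 1 := fun h => ciSup_le (F1 h)
  have φanti : Antitone φ := by
    intro h h' hh
    apply ciSup_mono (Fb h)
    intro k
    simp only [hF]
    split_ifs with h1 h2 h2
    · exact le_rfl
    · exact absurd (hh.trans h1) h2
    · exact hD0 k
    · exact le_rfl
  have φle : ∀ h, 0 < h → φ h ≤ 1 / h := by
    intro h hh
    apply ciSup_le
    intro k
    simp only [hF]
    split_ifs with h1
    · refine (hD1 k).trans ?_
      exact one_div_le_one_div_of_le hh h1
    · positivity
  have φlim : Tendsto φ atTop (nhds 0) := by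
    refine tendsto_of_tendsto_of_tendsto_of_le_of_le' tendsto_const_nhds
      (tendsto_const_nhds.div_atTop tendsto_id : Tendsto (fun h : ℝ => 1 / h) atTop (nhds 0))
      (Eventually.of_forall φ0) ?_
    filter_upwards [eventually_gt_atTop 0] with h hh using φle h hh
  have φsum : ∑' h : ℕ, ENNReal.ofReal (φ ((h : ℝ) + 1)) = ⊤ := by
    by_contra hne
    have hs1 : Summable (fun h : ℕ => φ ((h:ℝ) + 1)) := by
      have := ENNReal.summable_toReal hne
      simpa [ENNReal.toReal_ofReal (φ0 _)] using this
    have hs2 : Summable (fun h : ℕ => φ (h : ℝ)) := by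
      rw [← summable_nat_add_iff 1]
      simpa using hs1
    have hs3 := (summable_condensed_iff_of_nonneg (f := fun h : ℕ => φ (h : ℝ)) (fun h => φ0 _)
      (fun m n _ hmn => φanti (by exact_mod_cast hmn))).2 hs2
    apply hdiv
    refine Summable.of_nonneg_of_le (fun k => mul_nonneg (by positivity) (hD0 k)) (fun k => ?_) hs3
    apply mul_le_mul_of_nonneg_left _ (by positivity)
    push_cast
    refine le_trans (le_of_eq ?_) (le_ciSup (Fb _) k)
    simp [hF]
  refine measure_mono_null ?_ (bdkl φ φ0 (Or.inr (φanti.antitoneOn _)) φlim φsum)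
  rintro x ⟨hxb, hx⟩
  refine ⟨hxb, fun hS => hx ?_⟩
  obtain ⟨-, hinf⟩ := hS
  by_contra hnf
  rw [mem_setOf_eq, not_frequently, eventually_atTop] at hnf
  obtain ⟨K, hK⟩ := hnf
  apply hinf
  refine (fin_box (3 * 2 ^ K)).subset ?_
  rintro ⟨a, p⟩ hq
  have hq' : |(a 0 : ℝ) ^ 2 * x 0 + (a 1 : ℝ) ^ 2 * x 1 - (p : ℝ) ^ 2| < φ (ht a : ℝ) := hq
  by_cases h0 : 1 ≤ ht a
  · obtain ⟨k, hk⟩ := exists_lt_of_lt_ciSup hq'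
    have hak : (ht a : ℝ) ≤ 2 ^ k ∧ F (ht a) k = D k := by
      simp only [hF] at hk ⊢
      split_ifs at hk ⊢ with h1
      · exact ⟨h1, rfl⟩
      · exact absurd hk (not_lt.2 (abs_nonneg _))
    rw [hak.2] at hk
    have hak' : ht a ≤ 2 ^ k := by exact_mod_cast hak.1
    have hkK : k < K := by
      by_contra hc
      exact hK k (not_lt.1 hc) ⟨a, p, h0, hak', hxb, hk⟩
    have haK : ht a ≤ 2 ^ K := hak'.trans (Nat.pow_le_pow_right (by norm_num) hkK.le)
    refine ⟨by show ht a ≤ _; omega, ?_⟩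
    have := p_bound 1 a h0 p _ (φ1 _) zero_le_one x hxb hq'
    have h5 : (ht a : ℝ) ≤ 2 ^ K := by exact_mod_cast haK
    show |(p:ℝ)| ≤ _
    push_cast; linarith
  · have h0' : max (a 0).natAbs (a 1).natAbs = 0 := by
      have : ¬ 1 ≤ max (a 0).natAbs (a 1).natAbs := h0
      omega
    have a0 : a 0 = 0 := by omega
    have a1 : a 1 = 0 := by omega
    have h6 := hq'.trans_le (φ1 _)
    rw [a0, a1] at h6
    simp only [Int.cast_zero, ne_eq, OfNat.ofNat_ne_zero, not_false_eq_true, zero_pow, zero_mul,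
          add_zero, zero_sub, abs_neg, abs_pow, sq_abs] at h6
    refine ⟨by show ht a ≤ _; omega, ?_⟩
    show |(p:ℝ)| ≤ _
    have h7 : |(p:ℝ)| < 1 := by
      rw [← sq_lt_one_iff_abs_lt_one]; exact h6
    have h8 : (1:ℝ) ≤ 2 ^ K := one_le_pow₀ (by norm_num)
    push_cast; linarith


lemma mp_pair : MeasurePreserving (fun x : EuclideanSpace ℝ (Fin 2) => (x 0, x 1)) volume volume := by
  have h1 := EuclideanSpace.volume_preserving_symm_measurableEquiv_toLp (Fin 2)
  have h2 := (volume_preserving_finTwoArrow ℝ)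
  exact h2.comp h1

lemma slice_vol (A B q w : ℝ) (hA : 0 < A) (x : ℝ) :
    volume {y : ℝ | |B * x + A * y - q| < w} ≤ ENNReal.ofReal (2 * w / A) := by
  have : {y : ℝ | |B * x + A * y - q| < w} ⊆ Ioo ((q - B * x - w) / A) ((q - B * x + w) / A) := by
    intro y hy
    have hy' : |B * x + A * y - q| < w := hy
    rw [abs_lt] at hy'
    constructor
    · rw [div_lt_iff₀ hA]; linarith
    · rw [lt_div_iff₀ hA]; linarith
  refine (measure_mono this).trans ?_
  rw [Real.volume_Ioo]
  apply ENNReal.ofReal_le_ofReal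
  apply le_of_eq; field_simp; ring

lemma prod_vol (A B q w : ℝ) (hA : 0 < A) :
    volume {z : ℝ × ℝ | z.1 ∈ Ico (0:ℝ) 1 ∧ |B * z.1 + A * z.2 - q| < w} ≤ ENNReal.ofReal (2 * w / A) := by
  have hm : MeasurableSet {z : ℝ × ℝ | z.1 ∈ Ico (0:ℝ) 1 ∧ |B * z.1 + A * z.2 - q| < w} := by
    apply MeasurableSet.inter
    · exact measurable_fst measurableSet_Ico
    · have hf : Measurable (fun z : ℝ × ℝ => |B * z.1 + A * z.2 - q|) :=
        (by fun_prop : Continuous (fun z : ℝ × ℝ => |B * z.1 + A * z.2 - q|)).measurable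
      exact measurableSet_lt hf measurable_const
  rw [Measure.volume_eq_prod, Measure.prod_apply hm]
  calc ∫⁻ x, volume (Prod.mk x ⁻¹' {z : ℝ × ℝ | z.1 ∈ Ico (0:ℝ) 1 ∧ |B * z.1 + A * z.2 - q| < w})
      ≤ ∫⁻ x, (Ico (0:ℝ) 1).indicator (fun _ => ENNReal.ofReal (2 * w / A)) x := by
        apply lintegral_mono
        intro x
        by_cases hx : x ∈ Ico (0:ℝ) 1
        · simp only [indicator_of_mem hx]
          refine (measure_mono ?_).trans (slice_vol A B q w hA x)
          intro y hy
          exact hy.2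
        · rw [indicator_of_notMem hx]
          apply le_of_eq
          convert measure_empty (μ := (volume : Measure ℝ))
          rw [eq_empty_iff_forall_notMem]
          intro y hy
          exact hx hy.1
    _ = ENNReal.ofReal (2 * w / A) := by
        rw [lintegral_indicator measurableSet_Ico]; simp

lemma str_vol (w : ℝ) (a : Fin 2 → ℤ) (hh : 1 ≤ ht a) (p : ℤ) :
    volume (Str w a p) ≤ ENNReal.ofReal (2 * w / (ht a : ℝ) ^ 2) := by
  have hpos : (0:ℝ) < (ht a : ℝ) ^ 2 := by
    have : (0:ℝ) < ht a := by exact_mod_cast hh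
    positivity
  by_cases hc : (a 0).natAbs ≤ (a 1).natAbs
  · have hht : (a 1).natAbs = ht a := by simp [ht, hc]
    have hA : (a 1 : ℝ) ^ 2 = (ht a : ℝ) ^ 2 := by rw [sq_natAbs, hht]
    refine le_trans ?_ (prod_vol ((ht a : ℝ) ^ 2) ((a 0 : ℝ) ^ 2) ((p:ℝ) ^ 2) w hpos)
    refine le_trans (measure_mono ?_) (mp_pair.measure_preimage_le _)
    rintro x ⟨hx, h⟩
    rw [hA] at h
    exact ⟨hx 0, h⟩
  · have hht : (a 0).natAbs = ht a := by simp [ht]; omega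
    have hA : (a 0 : ℝ) ^ 2 = (ht a : ℝ) ^ 2 := by rw [sq_natAbs, hht]
    refine le_trans ?_ (prod_vol ((ht a : ℝ) ^ 2) ((a 1 : ℝ) ^ 2) ((p:ℝ) ^ 2) w hpos)
    have hsw : MeasurePreserving (Prod.swap ∘ (fun x : EuclideanSpace ℝ (Fin 2) => (x 0, x 1)))
      volume volume := (Measure.measurePreserving_swap).comp mp_pair
    refine le_trans (measure_mono ?_) (hsw.measure_preimage_le _)
    rintro x ⟨hx, h⟩
    rw [hA, add_comm] at h
    exact ⟨hx 1, h⟩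

lemma strips_vol (w : ℝ) (hw0 : 0 ≤ w) (hw : w ≤ 1) (a : Fin 2 → ℤ) (hh : 1 ≤ ht a) :
    volume (⋃ p, Str w a p) ≤ ENNReal.ofReal (14 * w / ht a) := by
  have h1 : (1:ℝ) ≤ ht a := by exact_mod_cast hh
  set G : Finset ℤ := Finset.Icc (-(3 * ht a : ℕ) : ℤ) (3 * ht a : ℕ) with hG
  have hsub : (⋃ p, Str w a p) ⊆ ⋃ p ∈ G, Str w a p := by
    intro x hx
    obtain ⟨p, hp⟩ := mem_iUnion.1 hx
    refine mem_iUnion₂.2 ⟨p, ?_, hp⟩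
    have := p_bound 1 a hh p w hw zero_le_one x hp.1 hp.2
    have h2 : |(p:ℝ)| ≤ ((3 * ht a : ℕ) : ℝ) := by push_cast; linarith
    have h3 : |p| ≤ ((3 * ht a : ℕ) : ℤ) := by exact_mod_cast h2
    rw [hG, Finset.mem_Icc]
    exact abs_le.1 h3
  refine (measure_mono hsub).trans ((measure_biUnion_finset_le _ _).trans ?_)
  refine (Finset.sum_le_card_nsmul _ _ _ (fun p _ => str_vol w a hh p)).trans ?_
  have hc : G.card = 6 * ht a + 1 := by rw [hG, Int.card_Icc]; omega
  rw [hc, nsmul_eq_mul, ← ENNReal.ofReal_natCast, ← ENNReal.ofReal_mul (by positivity)]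
  apply ENNReal.ofReal_le_ofReal
  rw [← mul_div_assoc, div_le_div_iff₀ (by positivity) (by positivity)]
  push_cast
  nlinarith [mul_nonneg hw0 (by linarith : (0:ℝ) ≤ ht a), mul_nonneg (mul_nonneg hw0 (by linarith : (0:ℝ) ≤ ht a)) (by linarith : (0:ℝ) ≤ ht a - 1)]

/-- The weight of an integer. -/
noncomputable def gw (z : ℤ) : ℝ := 1 / √(max 1 (z.natAbs : ℝ))

lemma gw_nonneg (z : ℤ) : 0 ≤ gw z := by unfold gw; positivity

lemma gw_sum (M : ℕ) : ∑ z ∈ Finset.Icc (-(M:ℤ)) M, gw z ≤ 1 + 4 * √M := by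
  induction M with
  | zero => simp [gw]
  | succ M ih =>
    have hset : Finset.Icc (-((M + 1 : ℕ):ℤ)) ((M + 1 : ℕ) : ℤ) =
        insert (-((M + 1 : ℕ):ℤ)) (insert ((M + 1 : ℕ) : ℤ) (Finset.Icc (-(M:ℤ)) M)) := by
      ext z
      simp only [Finset.mem_Icc, Finset.mem_insert]
      omega
    rw [hset, Finset.sum_insert, Finset.sum_insert]
    · have hg : gw (-((M + 1 : ℕ):ℤ)) = 1 / √((M:ℝ) + 1) ∧ gw ((M + 1 : ℕ):ℤ) = 1 / √((M:ℝ) + 1) := by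
        have : max (1:ℝ) ((M:ℝ) + 1) = M + 1 := max_eq_right (by linarith [Nat.cast_nonneg (α := ℝ) M])
        constructor
        · unfold gw; rw [Int.natAbs_neg, Int.natAbs_natCast]; push_cast; rw [this]
        · unfold gw; rw [Int.natAbs_natCast]; push_cast; rw [this]
      rw [hg.1, hg.2]
      have hv : 0 < √((M:ℝ) + 1) := Real.sqrt_pos.2 (by positivity)
      have hu : 0 ≤ √(M:ℝ) := Real.sqrt_nonneg _
      have huv : √(M:ℝ) ≤ √((M:ℝ) + 1) := Real.sqrt_le_sqrt (by linarith)
      have h1 : √((M:ℝ) + 1) ^ 2 = M + 1 := Real.sq_sqrt (by positivity)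
      have h2 : √(M:ℝ) ^ 2 = M := Real.sq_sqrt (by positivity)
      have h3 : 1 / √((M:ℝ) + 1) ≤ 2 * (√((M:ℝ) + 1) - √M) := by
        rw [div_le_iff₀ hv]; nlinarith
      push_cast
      linarith
    · simp
    · simp; omega

lemma inv_ht_le (a : Fin 2 → ℤ) (hh : 1 ≤ ht a) : 1 / (ht a : ℝ) ≤ gw (a 0) * gw (a 1) := by
  have h1 : (1:ℝ) ≤ ht a := by exact_mod_cast hh
  unfold gw
  rw [← mul_div_mul_comm, one_mul]
  apply one_div_le_one_div_of_le
  · positivity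
  · have e : ∀ i, √(max 1 ((a i).natAbs : ℝ)) ≤ √(ht a) := by
      intro i
      apply Real.sqrt_le_sqrt
      apply max_le h1
      have : (a i).natAbs ≤ ht a := by fin_cases i <;> simp [ht]
      exact_mod_cast this
    calc _ ≤ √(ht a) * √(ht a) := mul_le_mul (e 0) (e 1) (Real.sqrt_nonneg _) (Real.sqrt_nonneg _)
      _ = ht a := Real.mul_self_sqrt (by positivity)

/-- The bad part of level `N`. -/
def Bad (w ε : ℝ) (N : ℕ) : Set (EuclideanSpace ℝ (Fin 2)) :=
  {x | ∃ a p, 1 ≤ ht a ∧ ht a ≤ N ∧ ((a 1).natAbs : ℝ) ≤ ε * N ∧ x ∈ Str w a p}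

lemma bad_vol (w : ℝ) (hw0 : 0 ≤ w) (hw : w ≤ 1) (ε : ℝ) (hε : 0 < ε) (N : ℕ) (hN : 1 ≤ N)
    (hεN : 1 ≤ 2 * (ε * N)) : volume (Bad w ε N) ≤ ENNReal.ofReal (420 * (N * w * √ε)) := by
  classical
  have hN1 : (1:ℝ) ≤ N := by exact_mod_cast hN
  set M : ℕ := ⌊ε * N⌋₊ with hM
  set G : Finset (ℤ × ℤ) := (Finset.Icc (-(N:ℤ)) N ×ˢ Finset.Icc (-(M:ℤ)) M) with hG
  have hsub : Bad w ε N ⊆ ⋃ g ∈ G, {x | 1 ≤ ht ![g.1, g.2] ∧ x ∈ ⋃ p, Str w ![g.1, g.2] p} := by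
    rintro x ⟨a, p, h1, h2, h3, h4⟩
    have ha : (![a 0, a 1] : Fin 2 → ℤ) = a := by ext i; fin_cases i <;> rfl
    refine mem_iUnion₂.2 ⟨(a 0, a 1), ?_, ?_⟩
    · have h2' : max (a 0).natAbs (a 1).natAbs ≤ N := h2
      have h3' : (a 1).natAbs ≤ M := Nat.le_floor h3
      rw [hG, Finset.mem_product, Finset.mem_Icc, Finset.mem_Icc]
      simp only
      omega
    · simp only [ha]
      exact ⟨h1, mem_iUnion.2 ⟨p, h4⟩⟩
  refine (measure_mono hsub).trans ((measure_biUnion_finset_le _ _).trans ?_)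
  have hterm : ∀ g ∈ G, volume {x | 1 ≤ ht ![g.1, g.2] ∧ x ∈ ⋃ p, Str w ![g.1, g.2] p} ≤
      ENNReal.ofReal (14 * w * (gw g.1 * gw g.2)) := by
    intro g _
    by_cases h : 1 ≤ ht ![g.1, g.2]
    · simp only [h, true_and]
      refine (strips_vol w hw0 hw _ h).trans ?_
      apply ENNReal.ofReal_le_ofReal
      rw [div_eq_mul_one_div]
      apply mul_le_mul_of_nonneg_left _ (by positivity)
      exact inv_ht_le _ h
    · simp [h]
  refine (Finset.sum_le_sum hterm).trans ?_
  rw [← ENNReal.ofReal_sum_of_nonneg (fun g _ => by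
    have := gw_nonneg g.1; have := gw_nonneg g.2; positivity)]
  apply ENNReal.ofReal_le_ofReal
  rw [← Finset.mul_sum, hG, Finset.sum_product, ← Finset.sum_mul_sum]
  have hu : 1 ≤ √(N:ℝ) := Real.one_le_sqrt.2 hN1
  have hu2 : √(N:ℝ) ^ 2 = N := Real.sq_sqrt (by positivity)
  have hr : 0 < √ε := Real.sqrt_pos.2 hε
  have hr2 : √ε ^ 2 = ε := Real.sq_sqrt hε.le
  have hM1 : √(M:ℝ) ≤ √ε * √(N:ℝ) := by
    rw [← Real.sqrt_mul hε.le]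
    exact Real.sqrt_le_sqrt (Nat.floor_le (by positivity))
  have h1 : 1 ≤ 2 * (√ε * √(N:ℝ)) := by
    by_contra hc
    push Not at hc
    have h0 : 0 ≤ √ε * √(N:ℝ) := by positivity
    have h2 : (√ε * √(N:ℝ)) ^ 2 = ε * N := by rw [mul_pow, hr2, hu2]
    nlinarith
  have g1 : ∑ z ∈ Finset.Icc (-(N:ℤ)) N, gw z ≤ 5 * √(N:ℝ) := (gw_sum N).trans (by linarith)
  have g2 : ∑ z ∈ Finset.Icc (-(M:ℤ)) M, gw z ≤ 6 * (√ε * √(N:ℝ)) := (gw_sum M).trans (by linarith)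
  calc 14 * w * ((∑ z ∈ Finset.Icc (-(N:ℤ)) N, gw z) * ∑ z ∈ Finset.Icc (-(M:ℤ)) M, gw z)
      ≤ 14 * w * ((5 * √(N:ℝ)) * (6 * (√ε * √(N:ℝ)))) := by
        apply mul_le_mul_of_nonneg_left _ (by positivity)
        exact mul_le_mul g1 g2 (Finset.sum_nonneg fun z _ => gw_nonneg z) (by positivity)
    _ = 420 * (√(N:ℝ) ^ 2 * w * √ε) := by ring
    _ = _ := by rw [hu2]


lemma good_ae (D ε : ℕ → ℝ) (hD0 : ∀ k, 0 ≤ D k) (hD1 : ∀ k, D k ≤ 1 / 2 ^ k)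
    (hε : ∀ k, 0 < ε k) (hε2 : ∀ k, 1 ≤ 2 * (ε k * 2 ^ k))
    (hdiv : ¬ Summable (fun k => 2 ^ k * D k))
    (hconv : Summable (fun k => 2 ^ k * D k * √(ε k)))
    (bdkl : ∀ ψ' : ℝ → ℝ, (∀ h, 0 ≤ ψ' h) →
      (MonotoneOn ψ' (Set.Ici 0) ∨ AntitoneOn ψ' (Set.Ici 0)) →
      Tendsto ψ' atTop (nhds 0) →
      (∑' h : ℕ, ENNReal.ofReal (ψ' ((h : ℝ) + 1)) = ⊤) →
      volume (box2 \ S2 ψ') = 0) :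
    ∀ᵐ x : EuclideanSpace ℝ (Fin 2), x ∈ box2 → ∃ᶠ k in atTop, ∃ a p, ht a ≤ 2 ^ k ∧
      ε k * 2 ^ k < ((a 1).natAbs : ℝ) ∧ x ∈ Str (D k) a p := by
  have h1 := full_levels D hD0 hD1 hdiv bdkl
  have h2 : ∀ᵐ x : EuclideanSpace ℝ (Fin 2), ∀ᶠ k in atTop, x ∉ Bad (D k) (ε k) (2 ^ k) := by
    apply ae_eventually_notMem
    have hle : ∀ k, volume (Bad (D k) (ε k) (2 ^ k)) ≤ ENNReal.ofReal (420 * (2 ^ k * D k * √(ε k))) := by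
      intro k
      have hDk : D k ≤ 1 := by
        refine (hD1 k).trans ?_
        rw [div_le_one (by positivity)]; exact one_le_pow₀ (by norm_num)
      have := bad_vol (D k) (hD0 k) hDk (ε k) (hε k) (2 ^ k) Nat.one_le_two_pow
        (by push_cast; exact hε2 k)
      push_cast at this
      exact this
    refine ne_top_of_le_ne_top ?_ (ENNReal.tsum_le_tsum hle)
    rw [← ENNReal.ofReal_tsum_of_nonneg (fun k => by have := hD0 k; positivity) (hconv.mul_left 420)]
    exact ENNReal.ofReal_ne_top
  have h1' := measure_eq_zero_iff_ae_notMem.1 h1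
  filter_upwards [h1', h2] with x hx1 hx2 hxb
  have hx3 : ∃ᶠ k in atTop, ∃ a p, 1 ≤ ht a ∧ ht a ≤ 2 ^ k ∧ x ∈ Str (D k) a p := by
    by_contra hc
    exact hx1 ⟨hxb, hc⟩
  refine (hx3.and_eventually hx2).mono ?_
  rintro k ⟨⟨a, p, ha1, ha2, hs⟩, hb⟩
  refine ⟨a, p, ha2, ?_, hs⟩
  by_contra hc
  push Not at hc
  exact hb ⟨a, p, ha1, ha2, by push_cast; exact hc, hs⟩

/-- The key inequality comparing radii. -/
lemma radius_lt (t ε N ψN ψa A D : ℝ) (ht0 : 0 < t) (ht1 : t < 1) (hε0 : 0 < ε) (hε1 : ε ≤ 1)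
    (hN : 1 ≤ N) (hψN : 0 < ψN) (hψ : ψN ≤ ψa) (hA : ε * N < A)
    (hD : D ≤ N ^ (2 - 2 * t) * ψN ^ t * ε ^ 2) (hD0 : 0 < D) :
    (D / A ^ 2) ^ (1 / t) < ψa / A ^ 2 := by
  have hεN : 0 < ε * N := by positivity
  have hA0 : 0 < A := hεN.trans hA
  have hψa : 0 < ψa := hψN.trans_le hψ
  have h1 : D / A ^ 2 < (ψa / A ^ 2) ^ t := by
    rw [Real.div_rpow hψa.le (by positivity), ← Real.rpow_natCast, ← Real.rpow_mul hA0.le,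
      div_lt_div_iff₀ (by positivity) (by positivity)]
    have e1 : A ^ ((2:ℕ):ℝ) = A ^ (2 - 2 * t) * A ^ (((2:ℕ):ℝ) * t) := by
      rw [← Real.rpow_add hA0]; congr 1; push_cast; ring
    rw [e1, ← mul_assoc]
    apply mul_lt_mul_of_pos_right _ (by positivity)
    have e2 : ε ^ 2 ≤ ε ^ (2 - 2 * t) := by
      rw [← Real.rpow_natCast]
      exact Real.rpow_le_rpow_of_exponent_ge hε0 hε1 (by push_cast; linarith)
    have e3 : (ε * N) ^ (2 - 2 * t) < A ^ (2 - 2 * t) :=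
      Real.rpow_lt_rpow hεN.le hA (by linarith)
    have e4 : ψN ^ t ≤ ψa ^ t := Real.rpow_le_rpow hψN.le hψ ht0.le
    rw [Real.mul_rpow hε0.le (by linarith)] at e3
    have p1 : 0 < N ^ (2 - 2 * t) := by positivity
    have p2 : 0 < ψN ^ t := by positivity
    calc D ≤ N ^ (2 - 2 * t) * ψN ^ t * ε ^ 2 := hD
      _ ≤ N ^ (2 - 2 * t) * ψN ^ t * ε ^ (2 - 2 * t) := by gcongr
      _ = ψN ^ t * (ε ^ (2 - 2 * t) * N ^ (2 - 2 * t)) := by ring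
      _ < ψN ^ t * A ^ (2 - 2 * t) := by gcongr
      _ ≤ ψa ^ t * A ^ (2 - 2 * t) := by gcongr
  calc (D / A ^ 2) ^ (1 / t) < ((ψa / A ^ 2) ^ t) ^ (1 / t) :=
        Real.rpow_lt_rpow (by positivity) h1 (by positivity)
    _ = ψa / A ^ 2 := by
        rw [← Real.rpow_mul (by positivity), mul_one_div_cancel ht0.ne', Real.rpow_one]

lemma div_part_lt (ψ : ℝ → ℝ) (hψ0 : ∀ h, 0 ≤ ψ h) (hanti : AntitoneOn ψ (Set.Ici 0))
    (t : ℝ) (ht0 : 0 < t) (ht1 : t < 1)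
    (bdkl : ∀ ψ' : ℝ → ℝ, (∀ h, 0 ≤ ψ' h) →
      (MonotoneOn ψ' (Set.Ici 0) ∨ AntitoneOn ψ' (Set.Ici 0)) →
      Tendsto ψ' atTop (nhds 0) →
      (∑' h : ℕ, ENNReal.ofReal (ψ' ((h : ℝ) + 1)) = ⊤) →
      volume (box2 \ S2 ψ') = 0)
    (hsum : ∑' h : ℕ,
        ENNReal.ofReal (ψ ((h : ℝ) + 1) ^ t * ((h : ℝ) + 1) ^ (2 - 2 * t)) = ⊤) :
    μH[1 + t] (S2 ψ) = ⊤ := by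
  have hxdiv := cond_div ψ hψ0 hanti t (2 - 2 * t) ht0 (by linarith) hsum
  obtain ⟨d, ε, hε, hd, hdx, hddiv, hdconv, hεlim, hε2⟩ := seq_choice _
    (fun k => by have := hψ0 (2 ^ k); positivity) hxdiv
  set D : ℕ → ℝ := fun k => d k / 2 ^ k with hD
  have hDd : ∀ k, 2 ^ k * D k = d k := fun k => by simp only [hD]; field_simp
  have hD0 : ∀ k, 0 ≤ D k := fun k => div_nonneg (hd k).1 (by positivity)
  have hD1 : ∀ k, D k ≤ 1 / 2 ^ k := fun k => div_le_div_of_nonneg_right (hd k).2 (by positivity)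
  have hDx : ∀ k, D k ≤ ((2:ℝ) ^ k) ^ (2 - 2 * t) * ψ (2 ^ k) ^ t * ε k ^ 2 := fun k => by
    simp only [hD]
    rw [div_le_iff₀ (by positivity)]
    refine (hdx k).trans (le_of_eq ?_)
    ring
  have hgood := good_ae D ε hD0 hD1 (fun k => (hε k).1) hε2 (by simpa only [hDd] using hddiv)
    (by simpa only [hDd] using hdconv) bdkl
  by_contra hne
  have hsl := slice_finite t ht0 (S2 ψ) hne
  -- transfer to the product
  have hprod : ∀ᵐ z : ℝ × ℝ, z.1 ∈ Ico (0:ℝ) 1 → z.2 ∈ Ico (0:ℝ) 1 → ∃ᶠ k in atTop, ∃ (a : Fin 2 → ℤ) (p : ℤ),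
      ht a ≤ 2 ^ k ∧ ε k * 2 ^ k < ((a 1).natAbs : ℝ) ∧
      |(a 0 : ℝ) ^ 2 * z.1 + (a 1 : ℝ) ^ 2 * z.2 - (p : ℝ) ^ 2| < D k := by
    have he : MeasurePreserving (fun z : ℝ × ℝ => (!₂[z.1, z.2] : EuclideanSpace ℝ (Fin 2))) volume volume := by
      have h1 := EuclideanSpace.volume_preserving_symm_measurableEquiv_toLp (Fin 2)
      have h2 := (volume_preserving_finTwoArrow ℝ)
      exact (h1.symm _).comp (h2.symm _)
    have := he.quasiMeasurePreserving.ae hgood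
    filter_upwards [this] with z hz h1 h2
    have hb : (!₂[z.1, z.2] : EuclideanSpace ℝ (Fin 2)) ∈ box2 := by
      intro i; fin_cases i
      · exact h1
      · exact h2
    refine (hz hb).mono ?_
    rintro k ⟨a, p, q1, q2, q3⟩
    exact ⟨a, p, q1, q2, q3.2⟩
  have hprod2 := Measure.ae_ae_of_ae_prod hprod
  have hfalse : ∀ᵐ x : ℝ, x ∉ Ioo (0:ℝ) 1 := by
    filter_upwards [hsl, hprod2] with x hx1 hx2 hx
    refine hx1.ne ?_
    set T : ℕ → Set (ℕ × (Fin 2 → ℤ) × ℤ) := fun n => {i | n ≤ i.1 ∧ ht i.2.1 ≤ 2 ^ i.1 ∧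
      ε i.1 * 2 ^ i.1 < ((i.2.1 1).natAbs : ℝ) ∧ 0 < D i.1} with hT
    set c : ℕ × (Fin 2 → ℤ) × ℤ → ℝ := fun i =>
      ((i.2.2 : ℝ) ^ 2 - (i.2.1 0 : ℝ) ^ 2 * x) / (i.2.1 1 : ℝ) ^ 2 with hc
    set R : ℕ × (Fin 2 → ℤ) × ℤ → ℝ := fun i => D i.1 / (i.2.1 1 : ℝ) ^ 2 with hR
    have hA1 : ∀ n, ∀ i ∈ T n, (1:ℝ) ≤ (i.2.1 1 : ℝ) ^ 2 := by
      intro n i hi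
      have h1 : (0:ℝ) < ((i.2.1 1).natAbs : ℝ) := lt_trans (by have := (hε i.1).1; positivity) hi.2.2.1
      have h2 : 1 ≤ (i.2.1 1).natAbs := by exact_mod_cast h1
      have h3 : (1:ℝ) ≤ ((i.2.1 1).natAbs : ℝ) := by exact_mod_cast h2
      rw [sq_natAbs]; nlinarith
    have hmtp := mtp_one c R T (fun n i hi => div_pos hi.2.2.2 (by linarith [hA1 n i hi])) t ht0 ht1 ?_
    · refine top_unique (hmtp.symm.le.trans (measure_mono ?_))
      rintro y ⟨hy, hyT⟩
      refine ⟨?_, ?_⟩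
      · intro i; fin_cases i
        · exact ⟨hx.1.le, hx.2⟩
        · exact ⟨hy.1.le, hy.2⟩
      · intro hfin
        obtain ⟨B, hB⟩ := (hfin.image (fun q : (Fin 2 → ℤ) × ℤ => ((q.1 1).natAbs : ℝ))).bddAbove
        obtain ⟨n, hn⟩ := eventually_atTop.1 (hεlim.eventually (eventually_ge_atTop B))
        obtain ⟨i, hi, hyi⟩ := hyT n
        have hnk := hn i.1 hi.1
        have hA := hA1 n i hi
        have hmem : (i.2.1, i.2.2) ∈ {q : (Fin 2 → ℤ) × ℤ |
          |(q.1 0 : ℝ) ^ 2 * (!₂[x, y] : EuclideanSpace ℝ (Fin 2)) 0 +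
            (q.1 1 : ℝ) ^ 2 * (!₂[x, y] : EuclideanSpace ℝ (Fin 2)) 1 - (q.2 : ℝ) ^ 2| <
            ψ ((max (q.1 0).natAbs (q.1 1).natAbs : ℕ) : ℝ)} := by
          show |(i.2.1 0 : ℝ) ^ 2 * x + (i.2.1 1 : ℝ) ^ 2 * y - (i.2.2 : ℝ) ^ 2| < ψ (ht i.2.1)
          have hψN : 0 < ψ (2 ^ i.1) := by
            rcases (hψ0 (2 ^ i.1)).eq_or_lt with hz | hz
            · have h := hDx i.1
              rw [← hz, Real.zero_rpow ht0.ne'] at h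
              have := hi.2.2.2
              linarith
            · exact hz
          have hψle : ψ (2 ^ i.1) ≤ ψ (ht i.2.1) :=
            hanti (by simp) (by simp) (by exact_mod_cast hi.2.1)
          have hr := radius_lt t (ε i.1) (2 ^ i.1) (ψ (2 ^ i.1)) (ψ (ht i.2.1)) ((i.2.1 1).natAbs : ℝ) (D i.1)
            ht0 ht1 (hε i.1).1 (hε i.1).2 (one_le_pow₀ (by norm_num)) hψN hψle hi.2.2.1 (hDx i.1) hi.2.2.2
          rw [← sq_natAbs] at hr
          rw [Metric.mem_closedBall, Real.dist_eq] at hyi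
          have h3 : |y - c i| < ψ (ht i.2.1) / (i.2.1 1 : ℝ) ^ 2 := hyi.trans_lt hr
          have hApos : (0:ℝ) < (i.2.1 1 : ℝ) ^ 2 := by linarith
          rw [lt_div_iff₀ hApos] at h3
          have hne : (i.2.1 1 : ℝ) ≠ 0 := by
            intro h0; rw [h0] at hApos; simp at hApos
          have h4 : (i.2.1 0 : ℝ) ^ 2 * x + (i.2.1 1 : ℝ) ^ 2 * y - (i.2.2 : ℝ) ^ 2 =
              (y - c i) * (i.2.1 1 : ℝ) ^ 2 := by
            simp only [hc]
            field_simp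
            ring
          rw [h4, abs_mul, abs_of_pos hApos]
          exact h3
        have := hB (mem_image_of_mem _ hmem)
        have h5 := hi.2.2.1
        linarith
    · intro n
      filter_upwards [hx2] with y hy hyI η hη
      have hfr := hy ⟨hx.1.le, hx.2⟩ ⟨hyI.1.le, hyI.2⟩
      have hsm : ∀ᶠ k : ℕ in atTop, (1:ℝ) / 2 ^ k < η := by
        have : Tendsto (fun k : ℕ => ((1:ℝ) / 2) ^ k) atTop (nhds 0) :=
          tendsto_pow_atTop_nhds_zero_of_lt_one (by norm_num) (by norm_num)
        filter_upwards [this.eventually (gt_mem_nhds hη)] with k hk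
        simpa [div_pow] using hk
      obtain ⟨k, ⟨a, p, q1, q2, q3⟩, hk1, hk2⟩ := (hfr.and_eventually (hsm.and (eventually_ge_atTop n))).exists
      have hmem : (k, a, p) ∈ T n := ⟨hk2, q1, q2, (abs_nonneg _).trans_lt q3⟩
      have hA := hA1 n _ hmem
      replace hA : (1:ℝ) ≤ (a 1 : ℝ) ^ 2 := hA
      have hApos : (0:ℝ) < (a 1 : ℝ) ^ 2 := by linarith
      refine ⟨(k, a, p), hmem, ?_, ?_⟩
      · simp only [hR]
        rw [div_le_iff₀ hApos]
        have := hD1 k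
        nlinarith
      · rw [Metric.mem_closedBall, Real.dist_eq]
        simp only [hR, hc]
        rw [le_div_iff₀ hApos]
        rw [← abs_of_pos hApos, ← abs_mul, abs_of_pos hApos]
        refine le_trans (le_of_eq ?_) q3.le
        congr 1
        have hne : (a 1 : ℝ) ≠ 0 := by
            intro h0; rw [h0] at hApos; simp at hApos
        field_simp
        ring
  have h0 := measure_eq_zero_iff_ae_notMem.2 hfalse
  simp at h0

lemma div_part_two (A : Set (EuclideanSpace ℝ (Fin 2))) (hA : volume A = 0) : μH[(2:ℝ)] A = 0 := by
  have h1 : (μH[(2:ℝ)] : Measure (EuclideanSpace ℝ (Fin 2))).IsAddHaarMeasure := by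
    have := MeasureTheory.isAddHaarMeasure_hausdorffMeasure (E := EuclideanSpace ℝ (Fin 2))
    simpa using this
  have h2 := Measure.isAddLeftInvariant_eq_smul (μH[(2:ℝ)] : Measure (EuclideanSpace ℝ (Fin 2))) volume
  rw [h2, Measure.smul_apply, hA, smul_zero]

theorem stmt17 (ψ : ℝ → ℝ) (hψ0 : ∀ h, 0 ≤ ψ h)
    (hmono : MonotoneOn ψ (Set.Ici 0) ∨ AntitoneOn ψ (Set.Ici 0))
    (hlim : Tendsto ψ atTop (nhds 0))
    (s : ℝ) (hs1 : 1 < s) (hs2 : s ≤ 2)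
    -- The Lebesgue full-measure statement for `S₂` (Theorem BDKL, divergent part):
    (bdkl : ∀ ψ' : ℝ → ℝ, (∀ h, 0 ≤ ψ' h) →
      (MonotoneOn ψ' (Set.Ici 0) ∨ AntitoneOn ψ' (Set.Ici 0)) →
      Tendsto ψ' atTop (nhds 0) →
      (∑' h : ℕ, ENNReal.ofReal (ψ' ((h : ℝ) + 1)) = ⊤) →
      volume (box2 \ S2 ψ') = 0) :
    ((∑' h : ℕ,
        ENNReal.ofReal (ψ ((h : ℝ) + 1) ^ (s - 1) * ((h : ℝ) + 1) ^ (4 - 2 * s)) ≠ ⊤) →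
      μH[s] (S2 ψ) = 0) ∧
    ((∑' h : ℕ,
        ENNReal.ofReal (ψ ((h : ℝ) + 1) ^ (s - 1) * ((h : ℝ) + 1) ^ (4 - 2 * s)) = ⊤) →
      μH[s] (S2 ψ) = μH[s] box2) := by
  have hanti : AntitoneOn ψ (Set.Ici 0) := by
    rcases hmono with hm | ha
    · have hz : ∀ h, 0 ≤ h → ψ h = 0 := by
        intro h hh
        refine le_antisymm ?_ (hψ0 h)
        apply ge_of_tendsto hlim
        filter_upwards [eventually_ge_atTop h] with y hy
        exact hm hh (hh.trans hy) hy
      intro x hx y hy _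
      rw [hz x hx, hz y hy]
    · exact ha
  refine ⟨conv_part ψ hψ0 hanti s hs1, fun hsum => ?_⟩
  have hsub : S2 ψ ⊆ box2 := fun x hx => hx.1
  rcases hs2.lt_or_eq with hlt | heq
  · have h := div_part_lt ψ hψ0 hanti (s - 1) (by linarith) (by linarith) bdkl (by
      rw [← hsum]
      refine tsum_congr fun h => ?_
      congr 3
      ring)
    rw [show 1 + (s - 1) = s by ring] at h
    rw [h]
    exact (top_unique (h.symm.le.trans (measure_mono hsub))).symm
  · subst heq
    have hnull := bdkl ψ hψ0 hmono hlim (by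
      rw [← hsum]
      refine tsum_congr fun h => ?_
      norm_num)
    have h2 := div_part_two _ hnull
    refine le_antisymm (measure_mono hsub) ?_
    calc μH[(2:ℝ)] box2 ≤ μH[(2:ℝ)] (S2 ψ ∪ box2 \ S2 ψ) := measure_mono (by
          intro x hx
          by_cases h : x ∈ S2 ψ
          · exact Or.inl h
          · exact Or.inr ⟨hx, h⟩)
      _ ≤ μH[(2:ℝ)] (S2 ψ) + μH[(2:ℝ)] (box2 \ S2 ψ) := measure_union_le _ _
      _ = μH[(2:ℝ)] (S2 ψ) := by rw [h2, add_zero]
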